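/- arXiv:2010.15375 — 2 statements merged into one kernel-verified Lean document; each statement's English description precedes it below -/
import Mathlib

section
/- If v_T converges pointwise on Y (as T → ∞) to a continuous limit function, or h_ε converges pointwise on Y (as ε → 0) to a continuous limit function, then d*(y0) = d̂*(y0) for all y0 ∈ Y. -/
open MeasureTheory Filter Set Topology
open scoped ENNReal NNReal

noncomputable section

namespace StochLP

/-- The model of the controlled stochastic discrete time system (controlled stochastic
recursion) `y(t+1) = f(y(t), u(t), s(t))` from the paper: `Y ⊂ ℝⁿ` is a compact forward
invariant state constraint set, `Uc` is a compact metric control space, `S` is a Polish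
noise space, `U` is an upper semicontinuous compact valued control constraint
multifunction (upper semicontinuity of a compact valued map into a compact space being
recorded as closedness of its graph), `f` is bounded, continuous in `(y,u)` and Borel
measurable in `s`, and `ν` is the common law of the i.i.d. noise elements `s(t)`. -/
structure Model (n : ℕ) (Uc S : Type) [MetricSpace Uc] [CompactSpace Uc]
    [MeasurableSpace Uc] [BorelSpace Uc] [TopologicalSpace S] [PolishSpace S]
    [MeasurableSpace S] [BorelSpace S] where
  Y : Set (Fin n → ℝ)
  U : (Fin n → ℝ) → Set Uc
  f : (Fin n → ℝ) → Uc → S → (Fin n → ℝ)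
  ν : Measure S
  ν_prob : IsProbabilityMeasure ν
  Y_compact : IsCompact Y
  Y_nonempty : Y.Nonempty
  U_nonempty : ∀ y ∈ Y, (U y).Nonempty
  U_compact : ∀ y ∈ Y, IsCompact (U y)
  graph_closed : IsClosed {p : (Fin n → ℝ) × Uc | p.1 ∈ Y ∧ p.2 ∈ U p.1}
  f_bounded : ∃ C : ℝ, ∀ y ∈ Y, ∀ (u : Uc) (s : S), ‖f y u s‖ ≤ C
  f_cont : ∀ s : S, ContinuousOn (fun p : (Fin n → ℝ) × Uc => f p.1 p.2 s) (Y ×ˢ univ)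
  f_meas : ∀ y ∈ Y, ∀ u : Uc, Measurable fun s => f y u s
  f_inv : ∀ y ∈ Y, ∀ u ∈ U y, ∀ s : S, f y u s ∈ Y

variable {n : ℕ} {Uc S : Type} [MetricSpace Uc] [CompactSpace Uc] [MeasurableSpace Uc]
  [BorelSpace Uc] [TopologicalSpace S] [PolishSpace S] [MeasurableSpace S] [BorelSpace S]

/-- A control plan: a sequence of Borel measurable selections of the multifunction `U`. -/
structure Plan (M : Model n Uc S) where
  π : ℕ → (Fin n → ℝ) → Uc
  measurable : ∀ t, Measurable (π t)
  feasible : ∀ t, ∀ y ∈ M.Y, π t y ∈ M.U y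

/-- The law of the state `y^{π,y₀}(t)` of the controlled stochastic recursion started at
`y₀` and driven by the i.i.d. noise with common law `ν`, defined by the Markov recursion.  -/
def stateLaw (M : Model n Uc S) (t : ℕ) :
    (ℕ → (Fin n → ℝ) → Uc) → (Fin n → ℝ) → Measure (Fin n → ℝ) :=
  Nat.rec (motive := fun _ => (ℕ → (Fin n → ℝ) → Uc) → (Fin n → ℝ) → Measure (Fin n → ℝ))
    (fun _ y => Measure.dirac y)
    (fun _ ih π y =>
      (M.ν.map fun s => M.f y (π 0 y) s).bind fun y' => ih (fun j => π (j + 1)) y') t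

/-- The joint law of the state-control pair `(y^{π,y₀}(t), u^{π,y₀}(t))`. -/
def saLaw (M : Model n Uc S) (t : ℕ) (π : ℕ → (Fin n → ℝ) → Uc) (y0 : Fin n → ℝ) :
    Measure ((Fin n → ℝ) × Uc) :=
  (stateLaw M t π y0).map fun z => (z, π t z)

/-- `E[q(y^{π,y₀}(t), u^{π,y₀}(t))]`. -/
def expSA (M : Model n Uc S) (t : ℕ) (π : ℕ → (Fin n → ℝ) → Uc) (y0 : Fin n → ℝ)
    (q : (Fin n → ℝ) → Uc → ℝ) : ℝ :=
  ∫ p, q p.1 p.2 ∂saLaw M t π y0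

/-- The finite horizon average expected cost `(1/T) E[Σ_{t=0}^{T-1} k(y(t),u(t))]`. -/
def costT (M : Model n Uc S) (k : (Fin n → ℝ) → Uc → ℝ) (T : ℕ) (π : ℕ → (Fin n → ℝ) → Uc)
    (y0 : Fin n → ℝ) : ℝ :=
  (1 / (T : ℝ)) * ∑ t ∈ Finset.range T, expSA M t π y0 k

/-- The optimal value `v_T(y₀)` of the finite horizon problem. -/
def vT (M : Model n Uc S) (k : (Fin n → ℝ) → Uc → ℝ) (T : ℕ) (y0 : Fin n → ℝ) : ℝ :=
  ⨅ π : Plan M, costT M k T π.π y0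

/-- The expected discounted cost `ε Σ_{t=0}^∞ (1-ε)^t E[k(y(t),u(t))]`. -/
def costDisc (M : Model n Uc S) (k : (Fin n → ℝ) → Uc → ℝ) (ε : ℝ)
    (π : ℕ → (Fin n → ℝ) → Uc) (y0 : Fin n → ℝ) : ℝ :=
  ε * ∑' t : ℕ, (1 - ε) ^ t * expSA M t π y0 k

/-- The optimal value `h_ε(y₀)` of the discounted problem. -/
def hEps (M : Model n Uc S) (k : (Fin n → ℝ) → Uc → ℝ) (ε : ℝ) (y0 : Fin n → ℝ) : ℝ :=
  ⨅ π : Plan M, costDisc M k ε π.π y0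

/-- The graph `G` of the multifunction `U`. -/
def graphG (M : Model n Uc S) : Set ((Fin n → ℝ) × Uc) := {p | p.1 ∈ M.Y ∧ p.2 ∈ M.U p.1}

/-- `E[φ(f(y,u,s))]`, the expectation over the noise of `φ` evaluated after one step. -/
def Ef (M : Model n Uc S) (φ : (Fin n → ℝ) → ℝ) (y : Fin n → ℝ) (u : Uc) : ℝ :=
  ∫ s, φ (M.f y u s) ∂M.ν

/-- A measure on `Y × Uc` is concentrated on the graph `G` (this encodes measures defined
on Borel subsets of `G`). -/
def onG (M : Model n Uc S) (γ : Measure ((Fin n → ℝ) × Uc)) : Prop := γ (graphG M)ᶜ = 0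

/-- The set `W` of stationary measures. -/
def Wset (M : Model n Uc S) : Set (Measure ((Fin n → ℝ) × Uc)) :=
  {γ | IsProbabilityMeasure γ ∧ onG M γ ∧
    ∀ φ : (Fin n → ℝ) → ℝ, Continuous φ → ∫ p, (Ef M φ p.1 p.2 - φ p.1) ∂γ = 0}

/-- The set `W(ε, y₀)` of discounted stationary measures. -/
def Weps (M : Model n Uc S) (ε : ℝ) (y0 : Fin n → ℝ) : Set (Measure ((Fin n → ℝ) × Uc)) :=
  {γ | IsProbabilityMeasure γ ∧ onG M γ ∧
    ∀ φ : (Fin n → ℝ) → ℝ, Continuous φ →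
      ∫ p, ((1 - ε) * (Ef M φ p.1 p.2 - φ p.1) + ε * (φ y0 - φ p.1)) ∂γ = 0}

/-- The optimal value `k*(ε, y₀)` of the IDLP problem over `W(ε, y₀)`. -/
def kStarEps (M : Model n Uc S) (k : (Fin n → ℝ) → Uc → ℝ) (ε : ℝ) (y0 : Fin n → ℝ) : ℝ :=
  sInf ((fun γ : Measure ((Fin n → ℝ) × Uc) => ∫ p, k p.1 p.2 ∂γ) '' Weps M ε y0)

/-- The optimal value `k*` of the IDLP problem over `W`. -/
def kStar (M : Model n Uc S) (k : (Fin n → ℝ) → Uc → ℝ) : ℝ :=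
  sInf ((fun γ : Measure ((Fin n → ℝ) × Uc) => ∫ p, k p.1 p.2 ∂γ) '' Wset M)

/-- The optimal value `μ*(ε, y₀)` of the problem dual to the IDLP problem over `W(ε,y₀)`. -/
def muStarEps (M : Model n Uc S) (k : (Fin n → ℝ) → Uc → ℝ) (ε : ℝ) (y0 : Fin n → ℝ) : ℝ :=
  sSup {r : ℝ | ∃ ψ : (Fin n → ℝ) → ℝ, Continuous ψ ∧
    r = sInf ((fun p : (Fin n → ℝ) × Uc =>
      k p.1 p.2 + (1 - ε) * (Ef M ψ p.1 p.2 - ψ p.1) + ε * (ψ y0 - ψ p.1)) '' graphG M)}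

/-- The optimal value `μ*` of the problem dual to the IDLP problem over `W`. -/
def muStar (M : Model n Uc S) (k : (Fin n → ℝ) → Uc → ℝ) : ℝ :=
  sSup {r : ℝ | ∃ ψ : (Fin n → ℝ) → ℝ, Continuous ψ ∧
    r = sInf ((fun p : (Fin n → ℝ) × Uc => k p.1 p.2 + Ef M ψ p.1 p.2 - ψ p.1) '' graphG M)}

/-- The feasible set `Ω(y₀)` of the augmented IDLP problem. -/
def OmegaSet (M : Model n Uc S) (y0 : Fin n → ℝ) :
    Set (Measure ((Fin n → ℝ) × Uc) × Measure ((Fin n → ℝ) × Uc)) :=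
  {p | p.1 ∈ Wset M ∧ IsFiniteMeasure p.2 ∧ onG M p.2 ∧
    ∀ φ : (Fin n → ℝ) → ℝ, Continuous φ →
      ∫ q, (φ y0 - φ q.1) ∂p.1 + ∫ q, (Ef M φ q.1 q.2 - φ q.1) ∂p.2 = 0}

/-- The optimal value `k*(y₀)` of the augmented IDLP problem. -/
def kStarAug (M : Model n Uc S) (k : (Fin n → ℝ) → Uc → ℝ) (y0 : Fin n → ℝ) : ℝ :=
  sInf ((fun p : Measure ((Fin n → ℝ) × Uc) × Measure ((Fin n → ℝ) × Uc) =>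
    ∫ q, k q.1 q.2 ∂p.1) '' OmegaSet M y0)

/-- Feasibility of `(μ, ψ, η)` for the problem dual to the augmented IDLP problem. -/
def DualFeas (M : Model n Uc S) (k : (Fin n → ℝ) → Uc → ℝ) (y0 : Fin n → ℝ)
    (ψ η : (Fin n → ℝ) → ℝ) (μ : ℝ) : Prop :=
  (∀ p ∈ graphG M, 0 ≤ k p.1 p.2 + (ψ y0 - ψ p.1) + Ef M η p.1 p.2 - η p.1 - μ) ∧
  (∀ p ∈ graphG M, 0 ≤ Ef M ψ p.1 p.2 - ψ p.1)

/-- The optimal value `d*(y₀)` of the dual (with continuous test functions) of the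
augmented IDLP problem. -/
def dStar (M : Model n Uc S) (k : (Fin n → ℝ) → Uc → ℝ) (y0 : Fin n → ℝ) : ℝ :=
  sSup {μ : ℝ | ∃ ψ η : (Fin n → ℝ) → ℝ, Continuous ψ ∧ Continuous η ∧
    DualFeas M k y0 ψ η μ}

/-- Bounded Borel measurable real valued functions. -/
def BddBorel (ψ : (Fin n → ℝ) → ℝ) : Prop := Measurable ψ ∧ ∃ C : ℝ, ∀ y, |ψ y| ≤ C

/-- The optimal value `d̂*(y₀)` of the relaxed dual (with bounded Borel test functions) of
the augmented IDLP problem. -/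
def dHatStar (M : Model n Uc S) (k : (Fin n → ℝ) → Uc → ℝ) (y0 : Fin n → ℝ) : ℝ :=
  sSup {μ : ℝ | ∃ ψ η : (Fin n → ℝ) → ℝ, BddBorel ψ ∧ BddBorel η ∧ DualFeas M k y0 ψ η μ}

/-- The occupational measure `γ^{π,y₀,T}`. -/
def occT (M : Model n Uc S) (T : ℕ) (π : ℕ → (Fin n → ℝ) → Uc) (y0 : Fin n → ℝ) :
    Measure ((Fin n → ℝ) × Uc) :=
  (T : ℝ≥0∞)⁻¹ • ∑ t ∈ Finset.range T, saLaw M t π y0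

/-- The discounted occupational measure `γ_d^{π,y₀,ε}`. -/
def discOcc (M : Model n Uc S) (ε : ℝ) (π : ℕ → (Fin n → ℝ) → Uc) (y0 : Fin n → ℝ) :
    Measure ((Fin n → ℝ) × Uc) :=
  ENNReal.ofReal ε • Measure.sum fun t : ℕ => ENNReal.ofReal (1 - ε) ^ t • saLaw M t π y0

/-- The set `Θ_ε(y₀)` of discounted occupational measures, as a set of probability
measures (carrying the topology of weak convergence). -/
def ThetaEps (M : Model n Uc S) (ε : ℝ) (y0 : Fin n → ℝ) :
    Set (ProbabilityMeasure ((Fin n → ℝ) × Uc)) :=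
  {μ | ∃ π : Plan M, μ.toMeasure = discOcc M ε π.π y0}

/-- `Θ_ε := ∪_{y₀ ∈ Y} Θ_ε(y₀)`. -/
def ThetaEpsAll (M : Model n Uc S) (ε : ℝ) : Set (ProbabilityMeasure ((Fin n → ℝ) × Uc)) :=
  ⋃ y0 ∈ M.Y, ThetaEps M ε y0

/-- The set `Γ_T(y₀)` of occupational measures. -/
def GammaT (M : Model n Uc S) (T : ℕ) (y0 : Fin n → ℝ) :
    Set (ProbabilityMeasure ((Fin n → ℝ) × Uc)) :=
  {μ | ∃ π : Plan M, μ.toMeasure = occT M T π.π y0}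

/-- `Γ_T := ∪_{y₀ ∈ Y} Γ_T(y₀)`. -/
def GammaTAll (M : Model n Uc S) (T : ℕ) : Set (ProbabilityMeasure ((Fin n → ℝ) × Uc)) :=
  ⋃ y0 ∈ M.Y, GammaT M T y0

/-- `W` as a set of probability measures. -/
def WsetPM (M : Model n Uc S) : Set (ProbabilityMeasure ((Fin n → ℝ) × Uc)) :=
  {μ | μ.toMeasure ∈ Wset M}

/-- `W(ε,y₀)` as a set of probability measures. -/
def WepsPM (M : Model n Uc S) (ε : ℝ) (y0 : Fin n → ℝ) :
    Set (ProbabilityMeasure ((Fin n → ℝ) × Uc)) :=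
  {μ | μ.toMeasure ∈ Weps M ε y0}

/-- The set of finite convex combinations of elements of a set of probability measures,
i.e. its convex hull. -/
def convexCombos {α : Type*} [MeasurableSpace α] (A : Set (ProbabilityMeasure α)) :
    Set (ProbabilityMeasure α) :=
  {μ | ∃ (m : ℕ) (w : Fin m → ℝ≥0) (γ : Fin m → ProbabilityMeasure α),
    (∀ i, γ i ∈ A) ∧ (∑ i, w i) = 1 ∧
    μ.toMeasure = ∑ i, (w i : ℝ≥0∞) • (γ i).toMeasure}

/-- Membership in the set `D₁(y₀)`. -/
def D1mem (M : Model n Uc S) (y0 : Fin n → ℝ) (γ : Measure ((Fin n → ℝ) × Uc)) : Prop :=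
  ∃ ξ : ℕ → Measure ((Fin n → ℝ) × Uc),
    (∀ l, IsFiniteMeasure (ξ l) ∧ onG M (ξ l)) ∧
    ∀ φ : (Fin n → ℝ) → ℝ, Continuous φ →
      Tendsto (fun l => ∫ q, (Ef M φ q.1 q.2 - φ q.1) ∂ξ l) atTop
        (𝓝 (∫ q, (φ q.1 - φ y0) ∂γ))

/-- A control plan is periodic regime generating (PRG) for the initial point `y₀`. -/
def IsPRG (M : Model n Uc S) (π : Plan M) (y0 : Fin n → ℝ) : Prop :=
  ∃ T0 Tp : ℕ, 0 < Tp ∧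
    ∀ q : ((Fin n → ℝ) × Uc) → ℝ, Continuous q →
      ∀ t, T0 ≤ t → ∫ p, q p ∂saLaw M t π.π y0 = ∫ p, q p ∂saLaw M (t + Tp) π.π y0

/-- The optimal value `V_per(y₀)` over periodic regime generating control plans. -/
def Vper (M : Model n Uc S) (k : (Fin n → ℝ) → Uc → ℝ) (y0 : Fin n → ℝ) : ℝ :=
  sInf {c : ℝ | ∃ π : Plan M, IsPRG M π y0 ∧
    Tendsto (fun T => costT M k T π.π y0) atTop (𝓝 c)}

/-- The optimal value `k*_θ(y₀)` of the perturbed augmented IDLP problem. -/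
def kStarTheta (M : Model n Uc S) (k θ : (Fin n → ℝ) → Uc → ℝ) (y0 : Fin n → ℝ) : ℝ :=
  sInf ((fun p : Measure ((Fin n → ℝ) × Uc) × Measure ((Fin n → ℝ) × Uc) =>
    ∫ q, k q.1 q.2 ∂p.1 + ∫ q, θ q.1 q.2 ∂p.2) '' OmegaSet M y0)

/-- Feasibility of `(μ, ψ, η)` for the perturbed dual problem. -/
def DualFeasTheta (M : Model n Uc S) (k θ : (Fin n → ℝ) → Uc → ℝ) (y0 : Fin n → ℝ)
    (ψ η : (Fin n → ℝ) → ℝ) (μ : ℝ) : Prop :=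
  (∀ p ∈ graphG M, 0 ≤ k p.1 p.2 + (ψ y0 - ψ p.1) + Ef M η p.1 p.2 - η p.1 - μ) ∧
  (∀ p ∈ graphG M, -θ p.1 p.2 ≤ Ef M ψ p.1 p.2 - ψ p.1)

/-- The optimal value `d*_θ(y₀)` of the perturbed dual problem. -/
def dStarTheta (M : Model n Uc S) (k θ : (Fin n → ℝ) → Uc → ℝ) (y0 : Fin n → ℝ) : ℝ :=
  sSup {μ : ℝ | ∃ ψ η : (Fin n → ℝ) → ℝ, Continuous ψ ∧ Continuous η ∧
    DualFeasTheta M k θ y0 ψ η μ}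

/-- The optimal value `d̄*_θ(y₀)` of the second form of the perturbed dual problem. -/
def dBarTheta (M : Model n Uc S) (k θ : (Fin n → ℝ) → Uc → ℝ) (y0 : Fin n → ℝ) : ℝ :=
  sSup {r : ℝ | ∃ ψ η : (Fin n → ℝ) → ℝ, Continuous ψ ∧ Continuous η ∧ r = ψ y0 ∧
    (∀ p ∈ graphG M, 0 ≤ k p.1 p.2 - ψ p.1 + Ef M η p.1 p.2 - η p.1) ∧
    (∀ p ∈ graphG M, -θ p.1 p.2 ≤ Ef M ψ p.1 p.2 - ψ p.1)}

section Selection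

variable {X G : Type*} [MetricSpace G]

/-- The points of `A y` at which `q` attains its minimum over `A y`. -/
def argminOn (A : X → Set G) (q : G → ℝ) (y : X) : Set G := {p ∈ A y | ∀ p' ∈ A y, q p ≤ q p'}

theorem argminOn_nonempty [CompactSpace G] {A : X → Set G} {q : G → ℝ}
    (hq : LowerSemicontinuous q) {y : X} (hc : IsClosed (A y)) (hne : (A y).Nonempty) :
    (argminOn A q y).Nonempty := by
  obtain ⟨a, ha, h⟩ :=
    LowerSemicontinuousOn.exists_isMinOn hne hc.isCompact (hq.lowerSemicontinuousOn _)
  exact ⟨a, ha, fun p hp => h hp⟩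

theorem isClosed_argminOn {A : X → Set G} {q : G → ℝ} (hq : LowerSemicontinuous q) {y : X}
    (hc : IsClosed (A y)) : IsClosed (argminOn A q y) := by
  have : argminOn A q y = A y ∩ ⋂ p' ∈ A y, q ⁻¹' Iic (q p') := by
    ext p; simp [argminOn]
  rw [this]
  exact hc.inter (isClosed_biInter fun p' _ => hq.isClosed_preimage _)

theorem measurableSet_hit_argminOn [MeasurableSpace X] [CompactSpace G] {A : X → Set G} {q : G → ℝ}
    (hq : LowerSemicontinuous q) (hc : ∀ y, IsClosed (A y))
    (hm : ∀ K : Set G, IsClosed K → MeasurableSet {y | (A y ∩ K).Nonempty})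
    (K : Set G) (hK : IsClosed K) : MeasurableSet {y | (argminOn A q y ∩ K).Nonempty} := by
  have key : {y | (argminOn A q y ∩ K).Nonempty} = {y | (A y ∩ K).Nonempty} ∩
      ⋂ r : ℚ, ({y | (A y ∩ q ⁻¹' Iic (r : ℝ)).Nonempty}ᶜ ∪
        {y | (A y ∩ (K ∩ q ⁻¹' Iic (r : ℝ))).Nonempty}) := by
    ext y
    simp only [mem_ofPred_eq, mem_inter_iff, mem_iInter, mem_union, mem_compl_iff]
    constructor
    · rintro ⟨p, ⟨hpA, hp⟩, hpK⟩
      refine ⟨⟨p, hpA, hpK⟩, fun r => ?_⟩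
      rw [or_iff_not_imp_left, not_not]
      rintro ⟨p', hp'A, hp'⟩
      exact ⟨p, hpA, hpK, (hp p' hp'A).trans hp'⟩
    · rintro ⟨hAK, h⟩
      obtain ⟨p, hp, hmin⟩ := LowerSemicontinuousOn.exists_isMinOn hAK
        ((hc y).inter hK).isCompact (hq.lowerSemicontinuousOn _)
      refine ⟨p, ⟨hp.1, fun p' hp' => ?_⟩, hp.2⟩
      by_contra! hlt
      obtain ⟨r, hr1, hr2⟩ := exists_rat_btwn hlt
      rcases h r with h | ⟨p'', hp''A, hp''K, hp''⟩
      · exact h ⟨p', hp', hr1.le⟩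
      · exact absurd (hmin ⟨hp''A, hp''K⟩) (not_le.mpr (lt_of_le_of_lt hp'' hr2))
  rw [key]
  exact (hm K hK).inter (MeasurableSet.iInter fun r =>
    (hm _ (hq.isClosed_preimage _)).compl.union (hm _ (hK.inter (hq.isClosed_preimage _))))

/-- A lower semicontinuous function on the total space of a continuous surjection between
compact metric spaces has a Borel selection of fibrewise minimizers. -/
theorem exists_measurable_argmin [CompactSpace G] [MeasurableSpace G] [BorelSpace G]
    [MetricSpace X] [MeasurableSpace X] [BorelSpace X] {pr : G → X} (hpr : Continuous pr)
    (hsurj : Function.Surjective pr) {q : G → ℝ} (hq : LowerSemicontinuous q) :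
    ∃ σ : X → G, Measurable σ ∧ (∀ y, pr (σ y) = y) ∧ ∀ p, q (σ (pr p)) ≤ q p := by
  rcases isEmpty_or_nonempty G with hG | hG
  · have : IsEmpty X := ⟨fun y => (hsurj y).elim fun p _ => hG.elim p⟩
    exact ⟨fun y => this.elim y, measurable_of_empty _, fun y => this.elim y, fun p => hG.elim p⟩
  let Q : ℕ → G → ℝ := fun n => Nat.casesOn n q fun m p => dist p (TopologicalSpace.denseSeq G m)
  have hQ : ∀ n, LowerSemicontinuous (Q n)
    | 0 => hq
    | n + 1 => (by fun_prop : Continuous fun p => dist p (TopologicalSpace.denseSeq G n)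
        ).lowerSemicontinuous
  let A : ℕ → X → Set G := fun n => Nat.rec (fun y => pr ⁻¹' {y}) (fun m B => argminOn B (Q m)) n
  have hsub : ∀ n y, A (n + 1) y ⊆ A n y := fun n y p hp => hp.1
  have hcl : ∀ n y, IsClosed (A n y) := by
    intro n
    induction n with
    | zero => exact fun y => isClosed_singleton.preimage hpr
    | succ n ih => exact fun y => isClosed_argminOn (hQ n) (ih y)
  have hne : ∀ n y, (A n y).Nonempty := by
    intro n
    induction n with
    | zero => exact fun y => hsurj y
    | succ n ih => exact fun y => argminOn_nonempty (hQ n) (hcl n y) (ih y)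
  have hm : ∀ n (K : Set G), IsClosed K → MeasurableSet {y | (A n y ∩ K).Nonempty} := by
    intro n
    induction n with
    | zero =>
      intro K hK
      have : {y | (A 0 y ∩ K).Nonempty} = pr '' K := by
        ext y
        exact ⟨fun ⟨p, hp, hpK⟩ => ⟨p, hpK, hp⟩, fun ⟨p, hpK, hp⟩ => ⟨p, hp, hpK⟩⟩
      rw [this]
      exact (hK.isCompact.image hpr).isClosed.measurableSet
    | succ n ih => exact measurableSet_hit_argminOn (hQ n) (hcl n) ih
  have hinter : ∀ y, (⋂ n, A n y).Nonempty := fun y =>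
    IsCompact.nonempty_iInter_of_sequence_nonempty_isCompact_isClosed _ (fun n => hsub n y)
      (fun n => hne n y) (hcl 0 y).isCompact (fun n => hcl n y)
  choose σ hσ using hinter
  simp only [mem_iInter] at hσ
  have huniq : ∀ y p, (∀ n, A n y p) → p = σ y := by
    intro y p hp
    have hd : ∀ n, dist p (TopologicalSpace.denseSeq G n) =
        dist (σ y) (TopologicalSpace.denseSeq G n) := fun n =>
      le_antisymm ((hp (n + 2)).2 _ (hσ y (n + 1))) ((hσ y (n + 2)).2 _ (hp (n + 1)))
    have heq : (fun z => dist p z) = fun z => dist (σ y) z :=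
      Continuous.ext_on (TopologicalSpace.denseRange_denseSeq G) (by fun_prop) (by fun_prop)
        (by rintro _ ⟨n, rfl⟩; exact hd n)
    have := congrFun heq p
    simp only [dist_self] at this
    exact (dist_eq_zero.mp this.symm).symm
  refine ⟨σ, measurable_of_isClosed fun K hK => ?_, fun y => hσ y 0, fun p =>
    (hσ (pr p) 1).2 p rfl⟩
  have : σ ⁻¹' K = ⋂ n, {y | (A n y ∩ K).Nonempty} := by
    ext y
    simp only [mem_preimage, mem_iInter, mem_ofPred_eq]
    refine ⟨fun h n => ⟨σ y, hσ y n, h⟩, fun h => ?_⟩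
    obtain ⟨p, hp⟩ := IsCompact.nonempty_iInter_of_sequence_nonempty_isCompact_isClosed
      (fun n => A n y ∩ K) (fun n => inter_subset_inter_left _ (hsub n y)) h
      ((hcl 0 y).inter hK).isCompact (fun n => (hcl n y).inter hK)
    simp only [mem_iInter] at hp
    rw [← huniq y p fun n => (hp n).1]
    exact (hp 0).2
  rw [this]
  exact MeasurableSet.iInter fun n => hm n K hK

end Selection

theorem lowerSemicontinuous_integral_comp {X G Ω : Type*} [TopologicalSpace X]
    [MeasurableSpace X] [OpensMeasurableSpace X] [TopologicalSpace G] [FirstCountableTopology G]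
    [MeasurableSpace Ω] (ν : Measure Ω) [IsProbabilityMeasure ν] {F : G → Ω → X}
    (hFc : ∀ ω, Continuous fun p => F p ω) (hFm : ∀ p, Measurable (F p)) {V : X → ℝ}
    (hV : LowerSemicontinuous V) {B : ℝ} (hB : ∀ y, |V y| ≤ B) :
    LowerSemicontinuous fun p => ∫ ω, V (F p ω) ∂ν := by
  have hVF : ∀ p, Measurable fun ω => V (F p ω) := fun p => hV.measurable.comp (hFm p)
  have hint : ∀ p, Integrable (fun ω => V (F p ω)) ν := fun p =>
    Integrable.of_bound (hVF p).aestronglyMeasurable B (ae_of_all _ fun ω => hB _)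
  have hnn : ∀ y, 0 ≤ V y + B := fun y => by linarith [neg_le_of_abs_le (hB y)]
  have heq : ∀ p, ENNReal.ofReal (∫ ω, V (F p ω) ∂ν + B) =
      ∫⁻ ω, ENNReal.ofReal (V (F p ω) + B) ∂ν := fun p => by
    rw [← ofReal_integral_eq_lintegral_ofReal (f := fun ω => V (F p ω) + B) ((hint p).add (integrable_const B))
      (ae_of_all _ fun ω => hnn _), integral_add (hint p) (integrable_const B)]
    simp
  have hlow : ∀ p, ENNReal.ofReal (∫ ω, V (F p ω) ∂ν + B) ≤
      liminf (fun p' => ENNReal.ofReal (∫ ω, V (F p' ω) ∂ν + B)) (𝓝 p) := by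
    intro p
    simp only [heq]
    refine le_trans (lintegral_mono fun ω => ?_) (lintegral_liminf_le
      fun p' => ((hVF p').add_const B).ennreal_ofReal)
    have hl : LowerSemicontinuous fun p' => V (F p' ω) := fun p' c h =>
      (hFc ω).continuousAt.eventually (hV _ c h)
    refine le_of_forall_lt fun c hc => ?_
    obtain ⟨d, hcd, hd⟩ := exists_between hc
    refine lt_of_lt_of_le hcd (le_liminf_of_le (by isBoundedDefault) ?_)
    have hd' : d.toReal - B < V (F p ω) := by
      have := (ENNReal.lt_ofReal_iff_toReal_lt hd.ne_top).mp hd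
      linarith
    filter_upwards [hl p _ hd'] with p' hp'
    rw [ENNReal.le_ofReal_iff_toReal_le hd.ne_top (hnn _)]
    linarith
  intro p c hc
  rcases lt_or_ge (c + B) 0 with hcB | hcB
  · refine Eventually.of_forall fun p' => ?_
    have : 0 ≤ ∫ ω, (V (F p' ω) + B) ∂ν := integral_nonneg fun ω => hnn _
    rw [integral_add (hint p') (integrable_const B)] at this
    simp only [integral_const, probReal_univ, one_smul] at this
    change c < _
    linarith
  · have h1 : ENNReal.ofReal (c + B) < ENNReal.ofReal (∫ ω, V (F p ω) ∂ν + B) :=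
      (ENNReal.ofReal_lt_ofReal_iff_of_nonneg hcB).mpr (by linarith)
    filter_upwards [eventually_lt_of_lt_liminf (h1.trans_le (hlow p))] with p' hp'
    have := (ENNReal.ofReal_lt_ofReal_iff_of_nonneg hcB).mp hp'
    linarith

section DynamicProgramming

variable {X G Ω : Type*} [MeasurableSpace X] [MeasurableSpace Ω]
  {ν : Measure Ω} [IsProbabilityMeasure ν] {pr : G → X} {F : G → Ω → X} {k : G → ℝ} {β C : ℝ}

theorem abs_integral_comp_le {X : Type*} {V : X → ℝ} {B : ℝ} (hB : ∀ y, |V y| ≤ B) (g : Ω → X) :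
    |∫ ω, V (g ω) ∂ν| ≤ B := by
  simpa using norm_integral_le_of_norm_le_const (μ := ν) (f := fun ω => V (g ω))
    (ae_of_all _ fun ω => hB _)

/-- `V T` is the optimal value, with discount factor `β` and horizon `T`, of the control problem
with state space `X`, state-action space `G` fibred over `X` by `pr`, transition map `F` driven by
noise of law `ν`, and running cost `k`. -/
structure IsValueIteration (ν : Measure Ω) (pr : G → X) (F : G → Ω → X) (k : G → ℝ) (β : ℝ)
    (V : ℕ → X → ℝ) : Prop where
  zero : ∀ y, V 0 y = 0
  measurable : ∀ T, Measurable (V T)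
  bounded : ∀ T, ∃ B, ∀ y, |V T y| ≤ B
  le : ∀ T p, V (T + 1) (pr p) ≤ k p + β * ∫ ω, V T (F p ω) ∂ν
  attained : ∀ T y, ∃ p, pr p = y ∧ V (T + 1) y = k p + β * ∫ ω, V T (F p ω) ∂ν

theorem exists_bellman_step [MetricSpace X] [BorelSpace X] [MetricSpace G] [CompactSpace G]
    [MeasurableSpace G] [BorelSpace G] (hpr : Continuous pr) (hsurj : Function.Surjective pr)
    (hFc : ∀ ω, Continuous fun p => F p ω) (hFm : ∀ p, Measurable (F p)) (hk : Continuous k)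
    (hkC : ∀ p, |k p| ≤ C) (hβ : 0 ≤ β) {V : X → ℝ} (hV : LowerSemicontinuous V)
    (hVb : ∃ B, ∀ y, |V y| ≤ B) :
    ∃ (V' : X → ℝ) (σ : X → G), (LowerSemicontinuous V' ∧ ∃ B, ∀ y, |V' y| ≤ B) ∧
      Measurable σ ∧ (∀ y, pr (σ y) = y) ∧
      (∀ y, V' y = k (σ y) + β * ∫ ω, V (F (σ y) ω) ∂ν) ∧
      ∀ p, V' (pr p) ≤ k p + β * ∫ ω, V (F p ω) ∂ν := by
  obtain ⟨B, hB⟩ := hVb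
  set q : G → ℝ := fun p => k p + β * ∫ ω, V (F p ω) ∂ν with hqdef
  have hI := lowerSemicontinuous_integral_comp ν hFc hFm hV hB
  have hq : LowerSemicontinuous q := hk.lowerSemicontinuous.add
    ((continuous_const.mul continuous_id).comp_lowerSemicontinuous hI
      fun a b hab => mul_le_mul_of_nonneg_left hab hβ)
  obtain ⟨σ, hσm, hσ, hmin⟩ := exists_measurable_argmin hpr hsurj hq
  refine ⟨fun y => q (σ y), σ, ⟨?_, C + β * B, fun y => ?_⟩, hσm, hσ, fun y => rfl, hmin⟩
  · rw [lowerSemicontinuous_iff_isClosed_preimage]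
    intro c
    have : (fun y => q (σ y)) ⁻¹' Iic c = pr '' (q ⁻¹' Iic c) := by
      ext y
      constructor
      · exact fun h => ⟨σ y, h, hσ y⟩
      · rintro ⟨p, hp, rfl⟩
        exact (hmin p).trans hp
    rw [this]
    exact ((hq.isClosed_preimage c).isCompact.image hpr).isClosed
  · refine (abs_add_le _ _).trans (add_le_add (hkC _) ?_)
    rw [abs_mul, abs_of_nonneg hβ]
    refine mul_le_mul_of_nonneg_left ?_ hβ
    exact abs_integral_comp_le hB _

/-- Value iteration exists, together with Borel selections of optimal actions. -/
theorem exists_valueIteration [MetricSpace X] [BorelSpace X] [MetricSpace G] [CompactSpace G]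
    [MeasurableSpace G] [BorelSpace G] (hpr : Continuous pr) (hsurj : Function.Surjective pr)
    (hFc : ∀ ω, Continuous fun p => F p ω) (hFm : ∀ p, Measurable (F p)) (hk : Continuous k)
    (hkC : ∀ p, |k p| ≤ C) (hβ : 0 ≤ β) :
    ∃ (V : ℕ → X → ℝ) (σ : ℕ → X → G), IsValueIteration ν pr F k β V ∧
      (∀ T, Measurable (σ T)) ∧ (∀ T y, pr (σ T y) = y) ∧
      ∀ T y, V (T + 1) y = k (σ T y) + β * ∫ ω, V T (F (σ T y) ω) ∂ν := by
  let W := {V : X → ℝ // LowerSemicontinuous V ∧ ∃ B, ∀ y, |V y| ≤ B}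
  choose! next sel hnext hselm hsel heq hle using fun V : W =>
    exists_bellman_step (ν := ν) hpr hsurj hFc hFm hk hkC hβ V.2.1 V.2.2
  let V : ℕ → W := fun T => Nat.rec ⟨fun _ => 0, lowerSemicontinuous_const, 0, fun _ => by simp⟩
    (fun _ V => ⟨next V, hnext V⟩) T
  exact ⟨fun T => (V T).1, fun T => sel (V T),
    ⟨fun y => rfl, fun T => (V T).2.1.measurable, fun T => (V T).2.2, fun T p => hle (V T) p,
      fun T y => ⟨sel (V T) y, hsel (V T) y, heq (V T) y⟩⟩,
    fun T => hselm (V T), fun T => hsel (V T), fun T => heq (V T)⟩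

theorem integrable_comp_noise {V : X → ℝ} (hV : Measurable V) {B : ℝ} (hB : ∀ y, |V y| ≤ B)
    {g : Ω → X} (hg : Measurable g) : Integrable (fun ω => V (g ω)) ν :=
  Integrable.of_bound (hV.comp hg).aestronglyMeasurable B (ae_of_all _ fun _ => hB _)

namespace IsValueIteration

variable {V : ℕ → X → ℝ}

theorem integrable (h : IsValueIteration ν pr F k β V) (hFm : ∀ p, Measurable (F p)) (T : ℕ)
    (p : G) : Integrable (fun ω => V T (F p ω)) ν :=
  let ⟨_, hB⟩ := h.bounded T
  integrable_comp_noise (h.measurable T) hB (hFm p)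

theorem abs_le (h : IsValueIteration ν pr F k β V) (hkC : ∀ p, |k p| ≤ C) (hβ : 0 ≤ β) (T : ℕ) :
    ∀ y, |V T y| ≤ C * ∑ t ∈ Finset.range T, β ^ t := by
  induction T with
  | zero => intro y; simp [h.zero y]
  | succ T ih =>
    intro y
    obtain ⟨p, -, hp⟩ := h.attained T y
    rw [hp, Finset.sum_range_succ', Finset.sum_congr rfl fun t _ => pow_succ' β t,
      ← Finset.mul_sum]
    have h1 := mul_le_mul_of_nonneg_left (abs_integral_comp_le (ν := ν) ih (F p)) hβ
    have h2 := abs_add_le (k p) (β * ∫ ω, V T (F p ω) ∂ν)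
    rw [abs_mul, abs_of_nonneg hβ] at h2
    have := hkC p
    simp only [pow_zero]
    linarith

theorem le_succ (h : IsValueIteration ν pr F k β V) (hFm : ∀ p, Measurable (F p))
    (hkC : ∀ p, |k p| ≤ C) (hβ : 0 ≤ β) (T : ℕ) : ∀ y, V T y ≤ V (T + 1) y + C * β ^ T := by
  induction T with
  | zero =>
    intro y
    have := h.abs_le hkC hβ 1 y
    simp only [Finset.range_one, Finset.sum_singleton, pow_zero, mul_one] at this
    have := neg_le_of_abs_le this
    simp only [h.zero y, pow_zero, mul_one]
    linarith
  | succ T ih =>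
    intro y
    obtain ⟨p, rfl, hp⟩ := h.attained (T + 1) y
    have h1 := h.le T p
    have h2 : ∫ ω, V T (F p ω) ∂ν ≤ ∫ ω, (V (T + 1) (F p ω) + C * β ^ T) ∂ν :=
      integral_mono (h.integrable hFm T p)
        ((h.integrable hFm (T + 1) p).add (integrable_const _)) fun ω => ih _
    rw [integral_add (h.integrable hFm (T + 1) p) (integrable_const _)] at h2
    simp only [integral_const, probReal_univ, one_smul] at h2
    have h3 := mul_le_mul_of_nonneg_left h2 hβ
    rw [hp, pow_succ]
    linarith

/-- Dual feasible test functions bound the optimal values from below. -/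
theorem ge_of_dualFeasible (h : IsValueIteration ν pr F k β V) (hFm : ∀ p, Measurable (F p))
    (hβ : 0 ≤ β) (hβ1 : β ≤ 1) {ψ η : X → ℝ} (hψ : Measurable ψ) (hη : Measurable η) {B D a : ℝ}
    (hψB : ∀ y, |ψ y| ≤ B) (hηD : ∀ y, |η y| ≤ D)
    (h1 : ∀ p, 0 ≤ k p - a - ψ (pr p) + ∫ ω, η (F p ω) ∂ν - η (pr p))
    (h2 : ∀ p, 0 ≤ ∫ ω, ψ (F p ω) ∂ν - ψ (pr p)) (T : ℕ) :
    ∀ y, (∑ t ∈ Finset.range T, β ^ t) * (a + ψ y) + η y - D ≤ V T y := by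
  induction T with
  | zero =>
    intro y
    simp only [Finset.range_zero, Finset.sum_empty, h.zero y]
    linarith [le_of_abs_le (hηD y)]
  | succ T ih =>
    intro y
    obtain ⟨p, rfl, hp⟩ := h.attained T y
    set s := ∑ t ∈ Finset.range T, β ^ t with hs
    have hs0 : 0 ≤ s := Finset.sum_nonneg fun t _ => pow_nonneg hβ t
    have iψ := integrable_comp_noise (ν := ν) hψ hψB (hFm p)
    have iη := integrable_comp_noise (ν := ν) hη hηD (hFm p)
    have i1 : Integrable (fun ω => s * (a + ψ (F p ω))) ν :=
      ((integrable_const a).add iψ).const_mul s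
    have i2 : Integrable (fun ω => s * (a + ψ (F p ω)) + η (F p ω)) ν := i1.add iη
    have h3 : ∫ ω, (s * (a + ψ (F p ω)) + η (F p ω) - D) ∂ν ≤ ∫ ω, V T (F p ω) ∂ν :=
      integral_mono (i2.sub (integrable_const D)) (h.integrable hFm T p) fun ω => ih _
    have h4 : ∫ ω, (s * (a + ψ (F p ω)) + η (F p ω) - D) ∂ν =
        s * (a + ∫ ω, ψ (F p ω) ∂ν) + ∫ ω, η (F p ω) ∂ν - D := by
      rw [integral_sub i2 (integrable_const D), integral_add i1 iη, integral_const_mul,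
        integral_add (integrable_const a) iψ]
      simp
    rw [h4] at h3
    have hD := le_of_abs_le (abs_integral_comp_le (ν := ν) hηD (F p))
    have h5 := mul_le_mul_of_nonneg_left h3 hβ
    have h6 := mul_nonneg (mul_nonneg hβ hs0) (h2 p)
    have h7 := mul_nonneg (sub_nonneg.mpr hβ1) (sub_nonneg.mpr hD)
    rw [hp, Finset.sum_range_succ', Finset.sum_congr rfl fun t _ => pow_succ' β t,
      ← Finset.mul_sum, ← hs, pow_zero]
    nlinarith [h1 p]

end IsValueIteration

end DynamicProgramming

section Duality

/-- If `c` has nonnegative integral against every finite measure annihilating a subspace `L` of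
`C(G)`, then `c` can be made almost nonnegative by adding an element of `L`. -/
theorem exists_mem_submodule_neg_lt_add {G : Type*} [MetricSpace G] [CompactSpace G]
    [MeasurableSpace G] [BorelSpace G] (c : C(G, ℝ)) (L : Submodule ℝ C(G, ℝ))
    (h : ∀ γ : Measure G, IsFiniteMeasure γ → (∀ g ∈ L, ∫ p, g p ∂γ = 0) → 0 ≤ ∫ p, c p ∂γ)
    {δ : ℝ} (hδ : 0 < δ) : ∃ g ∈ L, ∀ p, -δ < c p + g p := by
  by_contra! hcon
  set s : Set C(G, ℝ) := {g | ∀ p, 0 < g p} with hs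
  set e : C(G, ℝ) := c + ContinuousMap.const G δ with he
  have hsc : Convex ℝ s := by
    intro g hg g' hg' a b ha hb hab p
    rcases ha.eq_or_lt with rfl | ha
    · have : b = 1 := by linarith
      simpa [this] using hg' p
    · exact add_pos_of_pos_of_nonneg (mul_pos ha (hg p)) (mul_nonneg hb (hg' p).le)
  have hso : IsOpen s := by
    have : s = {g : C(G, ℝ) | MapsTo g univ (Ioi 0)} := by
      ext g; simp [hs, MapsTo]
    rw [this]
    exact ContinuousMap.isOpen_setOfPred_mapsTo isCompact_univ isOpen_Ioi
  have htc : Convex ℝ ((fun g => e + g) '' (L : Set C(G, ℝ))) := L.convex.translate e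
  have hdisj : Disjoint s ((fun g => e + g) '' (L : Set C(G, ℝ))) := by
    rw [Set.disjoint_left]
    rintro _ hgs ⟨g, hg, rfl⟩
    obtain ⟨p, hp⟩ := hcon g hg
    have := hgs p
    simp only [he, ContinuousMap.add_apply, ContinuousMap.const_apply] at this
    linarith
  obtain ⟨f, u, hfs, hft⟩ := geometric_hahn_banach_open hsc hso htc hdisj
  have hsmul : ∀ g ∈ s, ∀ r : ℝ, 0 < r → r * f g < u := fun g hg r hr => by
    simpa using hfs (r • g) fun p => mul_pos hr (hg p)
  have hone : (1 : C(G, ℝ)) ∈ s := fun p => one_pos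
  have hfle : ∀ g ∈ s, f g ≤ 0 := by
    intro g hg
    by_contra! hpos
    have := hsmul g hg ((|u| + 1) / f g) (by positivity)
    rw [div_mul_cancel₀ _ hpos.ne'] at this
    linarith [le_abs_self u]
  have hu : 0 ≤ u := by
    by_contra! hneg
    have h1 := hsmul 1 hone (-u / (2 * (1 - f 1)))
      (div_pos (by linarith) (by linarith [hfle 1 hone]))
    have h2 : 0 < 1 - f 1 := by linarith [hfle 1 hone]
    rw [div_mul_eq_mul_div, div_lt_iff₀ (by linarith)] at h1
    nlinarith [hfle 1 hone]
  have hfL : ∀ g ∈ L, f g = 0 := by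
    intro g hg
    by_contra hne
    have := hft _ ⟨((u - 1 - f e) / f g) • g, L.smul_mem _ hg, rfl⟩
    simp only [map_add, map_smul, smul_eq_mul] at this
    rw [div_mul_cancel₀ _ hne] at this
    linarith
  have hfe : u ≤ f e := by simpa using hft _ ⟨0, L.zero_mem, rfl⟩
  have hf1 : f 1 < 0 := by
    refine lt_of_le_of_ne (hfle 1 hone) fun h0 => ?_
    have hu' := hfs 1 hone
    have := hfle ((‖e‖ + 1) • (1 : C(G, ℝ)) + e) fun p => by
      have := neg_le_of_abs_le (e.norm_coe_le_norm p)
      simp only [ContinuousMap.add_apply, ContinuousMap.smul_apply, ContinuousMap.one_apply,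
        smul_eq_mul, mul_one]
      linarith
    rw [map_add, map_smul, h0, smul_zero, zero_add] at this
    linarith
  have hfnn : ∀ g : C(G, ℝ), (∀ p, 0 ≤ g p) → f g ≤ 0 := by
    intro g hg
    by_contra! hpos
    have := hfle (g + (f g / (2 * (-f 1))) • (1 : C(G, ℝ))) fun p => by
      have : 0 < f g / (2 * (-f 1)) := div_pos hpos (by linarith)
      simp only [ContinuousMap.add_apply, ContinuousMap.smul_apply, ContinuousMap.one_apply,
        smul_eq_mul, mul_one]
      linarith [hg p]
    have h2 : f g / (2 * (-f 1)) * f 1 = - f g / 2 := by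
      have := hf1.ne
      field_simp
    rw [map_add, map_smul, smul_eq_mul, h2] at this
    linarith
  let Λ : CompactlySupportedContinuousMap G ℝ →ₚ[ℝ] ℝ := PositiveLinearMap.mk₀
    { toFun := fun g => -f g.toContinuousMap
      map_add' := fun g g' => by
        have : (g + g').toContinuousMap = g.toContinuousMap + g'.toContinuousMap := rfl
        rw [this, map_add]; ring
      map_smul' := fun r g => by
        have : (r • g).toContinuousMap = r • g.toContinuousMap := rfl
        rw [this, map_smul]; simp }
    fun g hg => by
      have := hfnn g.toContinuousMap fun p => hg p
      simpa using this
  have hint : ∀ g : C(G, ℝ), ∫ p, g p ∂(RealRMK.rieszMeasure Λ) = -f g := fun g =>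
    RealRMK.integral_rieszMeasure Λ ⟨g, HasCompactSupport.of_compactSpace g⟩
  have h1 := h (RealRMK.rieszMeasure Λ) inferInstance fun g hg => by rw [hint, hfL g hg, neg_zero]
  rw [hint] at h1
  have h2 : f e = f c + δ * f 1 := by
    have : e = c + δ • (1 : C(G, ℝ)) := by ext p; simp [he]
    rw [this, map_add, map_smul, smul_eq_mul]
  nlinarith

variable {X G Ω : Type*} [MeasurableSpace X] [MeasurableSpace Ω]
  {ν : Measure Ω} [IsProbabilityMeasure ν] {pr : G → X} {F : G → Ω → X} {k : G → ℝ} {β C : ℝ}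

/-- A sequence of discounted finite horizon problems whose total weight tends to infinity and whose
normalized optimal values converge pointwise to `v`. -/
structure IsValueLimit (ν : Measure Ω) (pr : G → X) (F : G → Ω → X) (k : G → ℝ) (v : X → ℝ)
    (β : ℕ → ℝ) (T : ℕ → ℕ) (V : ℕ → ℕ → X → ℝ) : Prop where
  nonneg : ∀ j, 0 ≤ β j
  le_one : ∀ j, β j ≤ 1
  iter : ∀ j, IsValueIteration ν pr F k (β j) (V j)
  weight : Tendsto (fun j => ∑ t ∈ Finset.range (T j), β j ^ t) atTop atTop
  lim : ∀ y, Tendsto (fun j => V j (T j) y / ∑ t ∈ Finset.range (T j), β j ^ t) atTop (𝓝 (v y))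

namespace IsValueLimit

variable {v : X → ℝ} {b : ℕ → ℝ} {T : ℕ → ℕ} {V : ℕ → ℕ → X → ℝ}

theorem abs_le (h : IsValueLimit ν pr F k v b T V) (hkC : ∀ p, |k p| ≤ C) (hC : 0 ≤ C) (j : ℕ)
    (y : X) : |V j (T j) y / ∑ t ∈ Finset.range (T j), b j ^ t| ≤ C := by
  have hS : 0 ≤ ∑ t ∈ Finset.range (T j), b j ^ t :=
    Finset.sum_nonneg fun t _ => pow_nonneg (h.nonneg j) t
  rw [abs_div, abs_of_nonneg hS]
  exact div_le_of_le_mul₀ hS hC ((h.iter j).abs_le hkC (h.nonneg j) (T j) y)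

theorem le_integral (h : IsValueLimit ν pr F k v b T V) (hFm : ∀ p, Measurable (F p))
    (hkC : ∀ p, |k p| ≤ C) (p : G) : v (pr p) ≤ ∫ ω, v (F p ω) ∂ν := by
  have hC : 0 ≤ C := (abs_nonneg _).trans (hkC p)
  set s : ℕ → ℝ := fun j => ∑ t ∈ Finset.range (T j), b j ^ t with hs
  have hlim : Tendsto (fun j => ∫ ω, V j (T j) (F p ω) / s j ∂ν) atTop
      (𝓝 (∫ ω, v (F p ω) ∂ν)) := by
    refine tendsto_integral_of_dominated_convergence (fun _ => C) (fun j => ?_)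
      (integrable_const C) (fun j => ae_of_all _ fun ω => h.abs_le hkC hC j _)
      (ae_of_all _ fun ω => h.lim _)
    exact ((((h.iter j).measurable (T j)).comp (hFm p)).div_const _).aestronglyMeasurable
  have hlim' : Tendsto (fun j => 3 * C / s j + ∫ ω, V j (T j) (F p ω) / s j ∂ν) atTop
      (𝓝 (∫ ω, v (F p ω) ∂ν)) := by
    simpa using (h.weight.const_div_atTop (3 * C)).add hlim
  refine le_of_tendsto_of_tendsto (h.lim (pr p)) hlim' ?_
  filter_upwards [h.weight.eventually_gt_atTop 0] with j hj
  change V j (T j) (pr p) / s j ≤ _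
  rw [integral_div, ← add_div]
  refine div_le_div_of_nonneg_right ?_ hj.le
  have h1 := (h.iter j).le_succ hFm hkC (h.nonneg j) (T j) (pr p)
  have h2 := (h.iter j).le (T j) p
  have h3 := le_of_abs_le (hkC p)
  have h4 := neg_le_of_abs_le
    (abs_integral_comp_le (ν := ν) ((h.iter j).abs_le hkC (h.nonneg j) (T j)) (F p))
  have h5 : s j * (1 - b j) = 1 - b j ^ T j := geom_sum_mul_neg _ _
  have h6 := mul_le_mul_of_nonneg_left h4 (sub_nonneg.mpr (h.le_one j))
  have h7 := pow_le_one₀ (n := T j) (h.nonneg j) (h.le_one j)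
  have h8 := pow_nonneg (h.nonneg j) (T j)
  have h9 : (1 - b j) * -(C * s j) = -(C * (1 - b j ^ T j)) := by rw [← h5]; ring
  rw [h9] at h6
  nlinarith

theorem le_of_dualFeasible (h : IsValueLimit ν pr F k v b T V) (hFm : ∀ p, Measurable (F p))
    {ψ η : X → ℝ} (hψ : Measurable ψ) (hη : Measurable η) {B D μ : ℝ} {y0 : X}
    (hψB : ∀ y, |ψ y| ≤ B) (hηD : ∀ y, |η y| ≤ D)
    (h1 : ∀ p, 0 ≤ k p + (ψ y0 - ψ (pr p)) + ∫ ω, η (F p ω) ∂ν - η (pr p) - μ)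
    (h2 : ∀ p, 0 ≤ ∫ ω, ψ (F p ω) ∂ν - ψ (pr p)) : μ ≤ v y0 := by
  have hlim : Tendsto (fun j => μ - 2 * D / ∑ t ∈ Finset.range (T j), b j ^ t) atTop (𝓝 μ) := by
    simpa using (h.weight.const_div_atTop (2 * D)).const_sub μ
  refine le_of_tendsto_of_tendsto hlim (h.lim y0) ?_
  filter_upwards [h.weight.eventually_gt_atTop 0] with j hj
  have := (h.iter j).ge_of_dualFeasible (a := μ - ψ y0) hFm (h.nonneg j) (h.le_one j) hψ hη hψB hηD
    (fun p => by linarith [h1 p]) h2 (T j) y0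
  rw [le_div_iff₀ hj, sub_mul, div_mul_cancel₀ _ hj.ne']
  linarith [neg_le_of_abs_le (hηD y0)]

end IsValueLimit

variable [MetricSpace X] [BorelSpace X] [MetricSpace G] [CompactSpace G] [MeasurableSpace G]
  [BorelSpace G]

/-- Stationarity of `γ` passes from continuous to bounded Borel test functions. -/
theorem integral_integral_eq_of_stationary (hpr : Continuous pr)
    (hFc : ∀ ω, Continuous fun p => F p ω) (hFm : ∀ p, Measurable (F p)) (γ : Measure G)
    [IsFiniteMeasure γ]
    (hγ : ∀ φ : C(X, ℝ), ∫ p, ∫ ω, φ (F p ω) ∂ν ∂γ = ∫ p, φ (pr p) ∂γ)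
    {V : X → ℝ} (hV : Measurable V) {B : ℝ} (hB : ∀ y, |V y| ≤ B) :
    Integrable (fun p => ∫ ω, V (F p ω) ∂ν) γ ∧
      ∫ p, ∫ ω, V (F p ω) ∂ν ∂γ = ∫ p, V (pr p) ∂γ := by
  have hF : Measurable (Function.uncurry F) :=
    measurable_uncurry_of_continuous_of_measurable (u := F) hFc hFm
  have hint : ∀ {W : X → ℝ} {D : ℝ}, Measurable W → (∀ y, |W y| ≤ D) →
      Integrable (fun z : G × Ω => W (Function.uncurry F z)) (γ.prod ν) := fun hW hD =>
    Integrable.of_bound (hW.comp hF).aestronglyMeasurable _ (ae_of_all _ fun z => hD _)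
  have hmap : (γ.prod ν).map (Function.uncurry F) = γ.map pr := by
    refine ext_of_forall_integral_eq_of_IsFiniteMeasure fun φ => ?_
    rw [integral_map hF.aemeasurable φ.continuous.aestronglyMeasurable,
      integral_map hpr.measurable.aemeasurable φ.continuous.aestronglyMeasurable,
      integral_prod _ (hint φ.continuous.measurable φ.norm_coe_le_norm)]
    exact hγ φ.toContinuousMap
  refine ⟨(hint hV hB).integral_prod_left, ?_⟩
  have := integral_prod _ (hint hV hB)
  rw [← integral_map hF.aemeasurable hV.aestronglyMeasurable, hmap,
    integral_map hpr.measurable.aemeasurable hV.aestronglyMeasurable] at this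
  exact this.symm

theorem IsValueIteration.integral_le_of_stationary {V : ℕ → X → ℝ}
    (h : IsValueIteration ν pr F k β V) (hpr : Continuous pr)
    (hFc : ∀ ω, Continuous fun p => F p ω) (hFm : ∀ p, Measurable (F p)) (hk : Continuous k)
    (hβ : 0 ≤ β) (γ : Measure G) [IsFiniteMeasure γ]
    (hγ : ∀ φ : C(X, ℝ), ∫ p, ∫ ω, φ (F p ω) ∂ν ∂γ = ∫ p, φ (pr p) ∂γ) (T : ℕ) :
    ∫ p, V T (pr p) ∂γ ≤ (∑ t ∈ Finset.range T, β ^ t) * ∫ p, k p ∂γ := by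
  induction T with
  | zero => simp [h.zero]
  | succ T ih =>
    obtain ⟨B, hB⟩ := h.bounded T
    obtain ⟨B', hB'⟩ := h.bounded (T + 1)
    obtain ⟨h1, h2⟩ := integral_integral_eq_of_stationary hpr hFc hFm γ hγ (h.measurable T) hB
    have ik : Integrable k γ := BoundedContinuousFunction.integrable γ
      (BoundedContinuousFunction.mkOfCompact ⟨k, hk⟩)
    have h3 : ∫ p, V (T + 1) (pr p) ∂γ ≤ ∫ p, (k p + β * ∫ ω, V T (F p ω) ∂ν) ∂γ :=
      integral_mono (Integrable.of_bound
        ((h.measurable (T + 1)).comp hpr.measurable).aestronglyMeasurable B'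
        (ae_of_all _ fun p => hB' _)) (ik.add (h1.const_mul β)) fun p => h.le T p
    rw [integral_add ik (h1.const_mul β), integral_const_mul, h2] at h3
    rw [Finset.sum_range_succ', Finset.sum_congr rfl fun t _ => pow_succ' β t, ← Finset.mul_sum,
      pow_zero]
    nlinarith [mul_le_mul_of_nonneg_left ih hβ]

namespace IsValueLimit

variable {v : X → ℝ} {b : ℕ → ℝ} {T : ℕ → ℕ} {V : ℕ → ℕ → X → ℝ}

theorem integral_le (h : IsValueLimit ν pr F k v b T V) (hpr : Continuous pr)
    (hFc : ∀ ω, Continuous fun p => F p ω) (hFm : ∀ p, Measurable (F p)) (hk : Continuous k)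
    (hC : 0 ≤ C) (hkC : ∀ p, |k p| ≤ C) (γ : Measure G) [IsFiniteMeasure γ]
    (hγ : ∀ φ : C(X, ℝ), ∫ p, ∫ ω, φ (F p ω) ∂ν ∂γ = ∫ p, φ (pr p) ∂γ) :
    ∫ p, v (pr p) ∂γ ≤ ∫ p, k p ∂γ := by
  have hlim : Tendsto (fun j => ∫ p, V j (T j) (pr p) / ∑ t ∈ Finset.range (T j), b j ^ t ∂γ)
      atTop (𝓝 (∫ p, v (pr p) ∂γ)) := by
    refine tendsto_integral_of_dominated_convergence (fun _ => C) (fun j => ?_)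
      (integrable_const C) (fun j => ae_of_all _ fun p => h.abs_le hkC hC j _)
      (ae_of_all _ fun p => h.lim _)
    exact ((((h.iter j).measurable (T j)).comp hpr.measurable).div_const _).aestronglyMeasurable
  refine le_of_tendsto hlim ?_
  filter_upwards [h.weight.eventually_gt_atTop 0] with j hj
  rw [integral_div, div_le_iff₀' hj]
  exact (h.iter j).integral_le_of_stationary hpr hFc hFm hk (h.nonneg j) γ hγ (T j)

theorem exists_dual [CompactSpace X] (h : IsValueLimit ν pr F k v b T V) (hpr : Continuous pr)
    (hFc : ∀ ω, Continuous fun p => F p ω) (hFm : ∀ p, Measurable (F p)) (hk : Continuous k)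
    (hC : 0 ≤ C) (hkC : ∀ p, |k p| ≤ C) (hv : Continuous v) {δ : ℝ} (hδ : 0 < δ) :
    ∃ η : C(X, ℝ), ∀ p, -δ < k p - v (pr p) + ∫ ω, η (F p ω) ∂ν - η (pr p) := by
  have hcont : ∀ φ : C(X, ℝ), Continuous fun p => ∫ ω, φ (F p ω) ∂ν := fun φ =>
    continuous_of_dominated (bound := fun _ => ‖φ‖)
      (fun p => (φ.continuous.measurable.comp (hFm p)).aestronglyMeasurable)
      (fun p => ae_of_all _ fun ω => φ.norm_coe_le_norm _) (integrable_const _)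
      (ae_of_all _ fun ω => φ.continuous.comp (hFc ω))
  have hint : ∀ (φ : C(X, ℝ)) p, Integrable (fun ω => φ (F p ω)) ν := fun φ p =>
    integrable_comp_noise φ.continuous.measurable φ.norm_coe_le_norm (hFm p)
  let A : C(X, ℝ) →ₗ[ℝ] C(G, ℝ) :=
    { toFun := fun φ => ⟨fun p => ∫ ω, φ (F p ω) ∂ν - φ (pr p),
        (hcont φ).sub (φ.continuous.comp hpr)⟩
      map_add' := fun φ φ' => by
        ext p
        have := integral_add (hint φ p) (hint φ' p)
        simp only [ContinuousMap.add_apply, ContinuousMap.coe_mk, this]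
        ring
      map_smul' := fun r φ => by
        ext p
        simp only [ContinuousMap.smul_apply, ContinuousMap.coe_mk, smul_eq_mul, integral_const_mul,
          RingHom.id_apply]
        ring }
  have igr : ∀ (γ : Measure G) [IsFiniteMeasure γ] {g : G → ℝ}, Continuous g → Integrable g γ :=
    fun γ _ g hg => BoundedContinuousFunction.integrable γ
      (BoundedContinuousFunction.mkOfCompact ⟨g, hg⟩)
  obtain ⟨_, ⟨η, rfl⟩, hη⟩ := exists_mem_submodule_neg_lt_add
    ⟨fun p => k p - v (pr p), hk.sub (hv.comp hpr)⟩ (LinearMap.range A) (fun γ hfin hγ => by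
      have hst : ∀ φ : C(X, ℝ), ∫ p, ∫ ω, φ (F p ω) ∂ν ∂γ = ∫ p, φ (pr p) ∂γ := fun φ => by
        have := hγ (A φ) ⟨φ, rfl⟩
        rw [show (∫ p, A φ p ∂γ) = ∫ p, (∫ ω, φ (F p ω) ∂ν - φ (pr p)) ∂γ from rfl,
          integral_sub (igr γ (hcont φ)) (igr γ (g := fun p => φ (pr p)) (φ.continuous.comp hpr))] at this
        linarith
      have h1 := h.integral_le hpr hFc hFm hk hC hkC γ hst
      simp only [ContinuousMap.coe_mk]
      rw [integral_sub (igr γ hk) (igr γ (g := fun p => v (pr p)) (hv.comp hpr))]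
      linarith) hδ
  refine ⟨η, fun p => ?_⟩
  have : -δ < k p - v (pr p) + (∫ ω, η (F p ω) ∂ν - η (pr p)) := hη p
  linarith

end IsValueLimit

end Duality

section Reduction

open ProbabilityTheory

namespace Model

variable (M : Model n Uc S)

instance : CompactSpace M.Y := isCompact_iff_compactSpace.mp M.Y_compact

instance : IsProbabilityMeasure M.ν := M.ν_prob

/-- The admissible state-control pairs, over the subtype of admissible states. -/
def pairs : Set (M.Y × Uc) := {p | p.2 ∈ M.U p.1}

theorem isClosed_pairs : IsClosed M.pairs := by
  have : M.pairs = (fun p : M.Y × Uc => ((p.1 : Fin n → ℝ), p.2)) ⁻¹'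
      {p : (Fin n → ℝ) × Uc | p.1 ∈ M.Y ∧ p.2 ∈ M.U p.1} := by
    ext p; simp [pairs]
  rw [this]
  exact M.graph_closed.preimage (by fun_prop)

instance : CompactSpace M.pairs := isCompact_iff_compactSpace.mp M.isClosed_pairs.isCompact

/-- The current state of a state-control pair. -/
def state (p : M.pairs) : M.Y := p.1.1

/-- The next state produced by a state-control pair and a noise value. -/
def step (p : M.pairs) (s : S) : M.Y := ⟨M.f p.1.1 p.1.2 s, M.f_inv _ p.1.1.2 _ p.2 s⟩

/-- The restriction of a running cost to the state-control pairs. -/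
def pairCost (k : (Fin n → ℝ) → Uc → ℝ) (p : M.pairs) : ℝ := k p.1.1 p.1.2

theorem continuous_state : Continuous M.state := by unfold state; fun_prop

theorem surjective_state : Function.Surjective M.state := fun y =>
  let ⟨u, hu⟩ := M.U_nonempty y y.2
  ⟨⟨(y, u), hu⟩, rfl⟩

theorem continuous_step (s : S) : Continuous fun p => M.step p s :=
  ((M.f_cont s).comp_continuous (f := fun p : M.pairs => ((p.1.1 : Fin n → ℝ), p.1.2))
    (by fun_prop) fun p => ⟨p.1.1.2, mem_univ _⟩).subtype_mk _

theorem measurable_step (p : M.pairs) : Measurable (M.step p) :=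
  (M.f_meas _ p.1.1.2 _).subtype_mk

theorem measurable_uncurry_step : Measurable fun z : M.pairs × S => M.step z.1 z.2 :=
  measurable_uncurry_of_continuous_of_measurable (u := M.step) M.continuous_step M.measurable_step

theorem continuous_pairCost {k : (Fin n → ℝ) → Uc → ℝ}
    (hk : ContinuousOn (fun p : (Fin n → ℝ) × Uc => k p.1 p.2) (M.Y ×ˢ (univ : Set Uc))) :
    Continuous (M.pairCost k) :=
  hk.comp_continuous (f := fun p : M.pairs => ((p.1.1 : Fin n → ℝ), p.1.2))
    (by fun_prop) fun p => ⟨p.1.1.2, mem_univ _⟩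

theorem measurableEmbedding_pairs :
    MeasurableEmbedding fun p : M.pairs => ((p.1.1 : Fin n → ℝ), p.1.2) :=
  ((MeasurableEmbedding.subtype_coe M.Y_compact.measurableSet).prodMap MeasurableEmbedding.id).comp
    (MeasurableEmbedding.subtype_coe M.isClosed_pairs.measurableSet)

end Model

namespace Plan

variable {M : Model n Uc S}

/-- The plan that remains after the first time step. -/
def shift (π : Plan M) : Plan M :=
  ⟨fun t => π.π (t + 1), fun _ => π.measurable _, fun _ => π.feasible _⟩

/-- The state-control pair chosen by a plan at time `t`. -/
def act (π : Plan M) (t : ℕ) (y : M.Y) : M.pairs := ⟨(y, π.π t y), π.feasible t y y.2⟩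

theorem measurable_act (π : Plan M) (t : ℕ) : Measurable (π.act t) :=
  (measurable_id.prodMk ((π.measurable t).comp measurable_subtype_coe)).subtype_mk

theorem measurable_step_act (π : Plan M) :
    Measurable fun z : M.Y × S => M.step (π.act 0 z.1) z.2 :=
  M.measurable_uncurry_step.comp
    (((π.measurable_act 0).comp measurable_fst).prodMk measurable_snd)

/-- The transition kernel of the first time step. -/
def transition (π : Plan M) : Kernel M.Y M.Y :=
  (Kernel.id ×ₖ Kernel.const M.Y M.ν).map
    fun z : M.Y × S => M.step (π.act 0 z.1) z.2

instance (π : Plan M) : IsMarkovKernel π.transition :=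
  Kernel.IsMarkovKernel.map _ π.measurable_step_act

theorem transition_apply (π : Plan M) (y : M.Y) :
    π.transition y = M.ν.map (M.step (π.act 0 y)) := by
  rw [transition, Kernel.map_apply _ π.measurable_step_act,
    Kernel.prod_apply, Kernel.id_apply,
    Kernel.const_apply, Measure.dirac_prod,
    Measure.map_map π.measurable_step_act measurable_prodMk_left]
  rfl

/-- The law of the state at time `t` as a kernel in the initial state. -/
def stateKernel (t : ℕ) : Plan M → Kernel M.Y M.Y :=
  Nat.rec (fun _ => Kernel.id)
    (fun _ κ π => (κ π.shift).comp π.transition) t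

theorem stateKernel_succ (t : ℕ) (π : Plan M) :
    stateKernel (t + 1) π = (stateKernel t π.shift).comp π.transition := rfl

instance (t : ℕ) (π : Plan M) : IsMarkovKernel (stateKernel t π) := by
  induction t generalizing π with
  | zero => exact inferInstanceAs (IsMarkovKernel Kernel.id)
  | succ t ih =>
    have := ih π.shift
    rw [stateKernel_succ]
    infer_instance

theorem stateLaw_eq (t : ℕ) (π : Plan M) (y : M.Y) :
    stateLaw M t π.π y = (stateKernel t π y).map Subtype.val := by
  induction t generalizing π y with
  | zero =>
    change Measure.dirac (y : Fin n → ℝ) = (Kernel.id y).map Subtype.val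
    rw [Kernel.id_apply, Measure.map_dirac' measurable_subtype_coe]
  | succ t ih =>
    have h1 : (M.ν.map fun s => M.f y (π.π 0 y) s) = (π.transition y).map Subtype.val := by
      rw [transition_apply, Measure.map_map measurable_subtype_coe (M.measurable_step _)]
      rfl
    change (M.ν.map fun s => M.f y (π.π 0 y) s).bind (fun y' => stateLaw M t π.shift.π y') = _
    have hemb := MeasurableEmbedding.subtype_coe M.Y_compact.measurableSet
    have h2 : Measurable fun z : M.Y => (stateKernel t π.shift z).map Subtype.val :=
      (Measure.measurable_map _ measurable_subtype_coe).comp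
        (stateKernel t π.shift).measurable
    have h3 : AEMeasurable (fun y' => stateLaw M t π.shift.π y')
        ((π.transition y).map Subtype.val) := by
      rw [hemb.aemeasurable_map_iff]
      exact h2.aemeasurable.congr (ae_of_all _ fun z => (ih π.shift z).symm)
    rw [h1]
    refine Measure.ext fun A hA => ?_
    rw [Measure.bind_apply hA h3, hemb.lintegral_map, stateKernel_succ,
      Measure.map_apply measurable_subtype_coe hA, Kernel.comp_apply' _ _ _
        (measurable_subtype_coe hA)]
    refine lintegral_congr fun z => ?_
    rw [ih, Measure.map_apply measurable_subtype_coe hA]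

/-- The expected cost `E[c(y(t), u(t))]` under a plan, for a cost `c` on state-control pairs. -/
def expCost (π : Plan M) (c : M.pairs → ℝ) (t : ℕ) (y : M.Y) : ℝ :=
  ∫ z, c (π.act t z) ∂stateKernel t π y

theorem expSA_eq {k : (Fin n → ℝ) → Uc → ℝ} (hk : Measurable (M.pairCost k)) (t : ℕ) (π : Plan M)
    (y : M.Y) : expSA M t π.π y k = π.expCost (M.pairCost k) t y := by
  have h : saLaw M t π.π y = ((stateKernel t π y).map (π.act t)).map
      fun p : M.pairs => ((p.1.1 : Fin n → ℝ), p.1.2) := by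
    rw [saLaw, stateLaw_eq, Measure.map_map (by have := π.measurable t; fun_prop)
      measurable_subtype_coe, Measure.map_map M.measurableEmbedding_pairs.measurable
      (π.measurable_act t)]
    rfl
  rw [expSA, h, M.measurableEmbedding_pairs.integral_map]
  exact integral_map (π.measurable_act t).aemeasurable hk.aestronglyMeasurable

variable {c : M.pairs → ℝ} {C : ℝ}

theorem abs_expCost_le (π : Plan M) (hC : ∀ p, |c p| ≤ C) (t : ℕ) (y : M.Y) :
    |π.expCost c t y| ≤ C :=
  abs_integral_comp_le hC _

theorem measurable_expCost (π : Plan M) (hc : Measurable c) (t : ℕ) :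
    Measurable (π.expCost c t) :=
  ((hc.comp (π.measurable_act t)).stronglyMeasurable.integral_kernel (κ := stateKernel t π)).measurable

theorem expCost_zero (π : Plan M) (hc : Measurable c) (y : M.Y) :
    π.expCost c 0 y = c (π.act 0 y) := by
  change ∫ z, c (π.act 0 z) ∂(Kernel.id y) = _
  rw [Kernel.id_apply]
  exact integral_dirac' _ _ (hc.comp (π.measurable_act 0)).stronglyMeasurable

theorem expCost_succ (π : Plan M) (hc : Measurable c) (hC : ∀ p, |c p| ≤ C) (t : ℕ) (y : M.Y) :
    π.expCost c (t + 1) y = ∫ s, π.shift.expCost c t (M.step (π.act 0 y) s) ∂M.ν := by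
  rw [expCost, stateKernel_succ, Kernel.integral_comp
    (f := fun z => c (π.act (t + 1) z)) (Integrable.of_bound (hc.comp (π.measurable_act (t + 1))).aestronglyMeasurable C
      (ae_of_all _ fun _ => hC _)), transition_apply]
  exact integral_map (M.measurable_step _).aemeasurable
    (π.shift.measurable_expCost hc t).aestronglyMeasurable

/-- The expected cost over `T` steps with discount factor `β`. -/
def partialCost (π : Plan M) (c : M.pairs → ℝ) (β : ℝ) (T : ℕ) (y : M.Y) : ℝ :=
  ∑ t ∈ Finset.range T, β ^ t * π.expCost c t y

theorem integrable_expCost_step (π : Plan M) (hc : Measurable c) (hC : ∀ p, |c p| ≤ C) (t : ℕ)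
    (p : M.pairs) : Integrable (fun s => π.expCost c t (M.step p s)) M.ν :=
  integrable_comp_noise (π.measurable_expCost hc t) (π.abs_expCost_le hC t) (M.measurable_step p)

theorem integrable_partialCost_step (π : Plan M) (hc : Measurable c) (hC : ∀ p, |c p| ≤ C) (β : ℝ)
    (T : ℕ) (p : M.pairs) : Integrable (fun s => π.partialCost c β T (M.step p s)) M.ν :=
  integrable_finsetSum _ fun t _ => (π.integrable_expCost_step hc hC t p).const_mul _

theorem partialCost_succ (π : Plan M) (hc : Measurable c) (hC : ∀ p, |c p| ≤ C) (β : ℝ) (T : ℕ)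
    (y : M.Y) : π.partialCost c β (T + 1) y =
      c (π.act 0 y) + β * ∫ s, π.shift.partialCost c β T (M.step (π.act 0 y) s) ∂M.ν := by
  simp only [partialCost]
  rw [integral_finsetSum _ fun t _ => (π.shift.integrable_expCost_step hc hC t _).const_mul _,
    Finset.sum_range_succ', π.expCost_zero hc, pow_zero, one_mul, add_comm, Finset.mul_sum]
  refine congrArg _ (Finset.sum_congr rfl fun t _ => ?_)
  rw [π.expCost_succ hc hC, integral_const_mul, pow_succ', mul_assoc]

theorem le_partialCost {β : ℝ} {V : ℕ → M.Y → ℝ}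
    (h : IsValueIteration M.ν M.state M.step c β V) (hc : Measurable c) (hC : ∀ p, |c p| ≤ C)
    (hβ : 0 ≤ β) (T : ℕ) (π : Plan M) (y : M.Y) : V T y ≤ π.partialCost c β T y := by
  induction T generalizing π y with
  | zero => simp [h.zero, partialCost]
  | succ T ih =>
    rw [π.partialCost_succ hc hC]
    have h1 := integral_mono (h.integrable M.measurable_step T (π.act 0 y))
      (π.shift.integrable_partialCost_step hc hC β T _) fun s => ih π.shift _
    have h2 : V (T + 1) y ≤ _ := h.le T (π.act 0 y)
    linarith [mul_le_mul_of_nonneg_left h1 hβ]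

/-- The plan that follows prescribed Borel selectors. -/
def ofSelectors (σ : ℕ → M.Y → M.pairs) (hσ : ∀ t, Measurable (σ t))
    (hst : ∀ t y, M.state (σ t y) = y) : Plan M where
  π t := Function.extend Subtype.val (fun y => (σ t y).1.2)
    fun _ => (σ t ⟨_, M.Y_nonempty.some_mem⟩).1.2
  measurable t := (MeasurableEmbedding.subtype_coe M.Y_compact.measurableSet).measurable_extend
    (measurable_snd.comp (measurable_subtype_coe.comp (hσ t))) measurable_const
  feasible t y hy := by
    have h1 : Function.extend Subtype.val (fun y => (σ t y).1.2)
        (fun _ => (σ t ⟨_, M.Y_nonempty.some_mem⟩).1.2) y = (σ t ⟨y, hy⟩).1.2 :=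
      Subtype.val_injective.extend_apply _ _ (⟨y, hy⟩ : M.Y)
    have h2 : ((σ t ⟨y, hy⟩).1.1 : Fin n → ℝ) = y := congrArg Subtype.val (hst t ⟨y, hy⟩)
    have h3 := (σ t ⟨y, hy⟩).2
    rw [h1]
    simpa only [Model.pairs, mem_ofPred_eq, h2] using h3

theorem act_ofSelectors (σ : ℕ → M.Y → M.pairs) (hσ : ∀ t, Measurable (σ t))
    (hst : ∀ t y, M.state (σ t y) = y) (t : ℕ) (y : M.Y) :
    (ofSelectors σ hσ hst).act t y = σ t y :=
  Subtype.ext (Prod.ext (hst t y).symm (Subtype.val_injective.extend_apply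
    (fun y => (σ t y).1.2) (fun _ => (σ t ⟨_, M.Y_nonempty.some_mem⟩).1.2) y))

theorem partialCost_ofSelectors {β : ℝ} {V : ℕ → M.Y → ℝ}
    (h : IsValueIteration M.ν M.state M.step c β V) (hc : Measurable c) (hC : ∀ p, |c p| ≤ C)
    {σ : ℕ → M.Y → M.pairs} (hσ : ∀ t, Measurable (σ t)) (hst : ∀ t y, M.state (σ t y) = y)
    (hV : ∀ t y, V (t + 1) y = c (σ t y) + β * ∫ s, V t (M.step (σ t y) s) ∂M.ν) (T : ℕ)
    (y : M.Y) :
    (ofSelectors (fun t => σ (T - 1 - t)) (fun _ => hσ _) fun _ => hst _).partialCost c β T y =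
      V T y := by
  induction T generalizing y with
  | zero => simp [h.zero, partialCost]
  | succ T ih =>
    rw [partialCost_succ _ hc hC, act_ofSelectors, hV]
    have : (ofSelectors (fun t => σ (T + 1 - 1 - t)) (fun _ => hσ _) fun _ => hst _).shift =
        ofSelectors (fun t => σ (T - 1 - t)) (fun _ => hσ _) fun _ => hst _ := by
      have h1 : ∀ t, T + 1 - 1 - (t + 1) = T - 1 - t := fun t => by omega
      simp only [shift, ofSelectors, h1]
    simp only [this, ih]
    rfl

end Plan

end Reduction

section Values

variable (M : Model n Uc S) {k : (Fin n → ℝ) → Uc → ℝ} {β C ε : ℝ}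

theorem Model.exists_valueIteration {c : M.pairs → ℝ} (hc : Continuous c) (hC : ∀ p, |c p| ≤ C)
    (hβ : 0 ≤ β) : ∃ V, IsValueIteration M.ν M.state M.step c β V ∧
      ∀ T, ∃ π : Plan M, ∀ y, π.partialCost c β T y = V T y := by
  obtain ⟨V, σ, h, hσ, hst, hV⟩ := StochLP.exists_valueIteration (ν := M.ν) M.continuous_state
    M.surjective_state M.continuous_step M.measurable_step hc hC hβ
  exact ⟨V, h, fun T => ⟨_, Plan.partialCost_ofSelectors h hc.measurable hC hσ hst hV T⟩⟩

variable {M}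

theorem vT_eq (hk : Measurable (M.pairCost k)) (hC : ∀ p, |M.pairCost k p| ≤ C)
    {V : ℕ → M.Y → ℝ} (h : IsValueIteration M.ν M.state M.step (M.pairCost k) 1 V) {T : ℕ}
    {π : Plan M} (hπ : ∀ y, π.partialCost (M.pairCost k) 1 T y = V T y) (y : M.Y) :
    vT M k T y = V T y / T := by
  have hcost : ∀ π : Plan M, costT M k T π.π y = π.partialCost (M.pairCost k) 1 T y / T :=
    fun π => by simp [costT, Plan.partialCost, Plan.expSA_eq hk, div_eq_inv_mul]
  have hle : ∀ π : Plan M, V T y / T ≤ costT M k T π.π y := fun π => by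
    rw [hcost]
    exact div_le_div_of_nonneg_right (Plan.le_partialCost h hk hC zero_le_one T π y)
      (Nat.cast_nonneg T)
  have : Nonempty (Plan M) := ⟨π⟩
  refine le_antisymm ((ciInf_le ⟨V T y / T, ?_⟩ π).trans_eq (by rw [hcost, hπ])) (le_ciInf hle)
  rintro _ ⟨π, rfl⟩
  exact hle π

theorem abs_costDisc_sub_le (hk : Measurable (M.pairCost k)) (hC : ∀ p, |M.pairCost k p| ≤ C)
    (hε : 0 < ε) (hε1 : ε < 1) (T : ℕ) (π : Plan M) (y : M.Y) :
    |costDisc M k ε π.π y - ε * π.partialCost (M.pairCost k) (1 - ε) T y| ≤ C * (1 - ε) ^ T := by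
  have h0 : 0 ≤ 1 - ε := by linarith
  have hb : ∀ t, ‖(1 - ε) ^ t * π.expCost (M.pairCost k) t y‖ ≤ C * (1 - ε) ^ t := fun t => by
    rw [norm_mul, Real.norm_of_nonneg (pow_nonneg h0 t), mul_comm]
    exact mul_le_mul_of_nonneg_right (π.abs_expCost_le hC t y) (pow_nonneg h0 t)
  have hgeom := hasSum_geometric_of_lt_one h0 (by linarith : 1 - ε < 1)
  have hsum : Summable fun t => (1 - ε) ^ t * π.expCost (M.pairCost k) t y :=
    .of_norm_bounded (hgeom.summable.mul_left C) hb
  have htail := tsum_of_norm_bounded (hgeom.mul_left (C * (1 - ε) ^ T)) fun t =>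
    (hb (t + T)).trans_eq (by rw [pow_add]; ring)
  simp only [costDisc, Plan.expSA_eq hk]
  rw [← hsum.sum_add_tsum_nat_add T, mul_add, Plan.partialCost, add_sub_cancel_left, abs_mul,
    abs_of_pos hε]
  refine (mul_le_mul_of_nonneg_left htail hε.le).trans_eq ?_
  rw [sub_sub_cancel]
  field_simp

theorem abs_hEps_sub_le (hk : Measurable (M.pairCost k)) (hC : ∀ p, |M.pairCost k p| ≤ C)
    (hε : 0 < ε) (hε1 : ε < 1) {V : ℕ → M.Y → ℝ}
    (h : IsValueIteration M.ν M.state M.step (M.pairCost k) (1 - ε) V) {T : ℕ}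
    {π : Plan M} (hπ : ∀ y, π.partialCost (M.pairCost k) (1 - ε) T y = V T y) (y : M.Y) :
    |hEps M k ε y - ε * V T y| ≤ C * (1 - ε) ^ T := by
  have hle : ∀ π : Plan M, ε * V T y - C * (1 - ε) ^ T ≤ costDisc M k ε π.π y := fun π => by
    have h1 := Plan.le_partialCost h hk hC (by linarith) T π y
    have h2 := neg_le_of_abs_le (abs_costDisc_sub_le hk hC hε hε1 T π y)
    linarith [mul_le_mul_of_nonneg_left h1 hε.le]
  have : Nonempty (Plan M) := ⟨π⟩
  have h1 : ε * V T y - C * (1 - ε) ^ T ≤ hEps M k ε y := le_ciInf hle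
  have h2 : hEps M k ε y ≤ costDisc M k ε π.π y := by
    refine ciInf_le ⟨ε * V T y - C * (1 - ε) ^ T, ?_⟩ π
    rintro _ ⟨π, rfl⟩
    exact hle π
  have h3 := le_of_abs_le (abs_costDisc_sub_le hk hC hε hε1 T π y)
  rw [hπ] at h3
  rw [abs_le]
  constructor <;> linarith

theorem exists_isValueLimit_of_tendsto_vT (hk : Continuous (M.pairCost k))
    (hC : ∀ p, |M.pairCost k p| ≤ C) {v : M.Y → ℝ}
    (hv : ∀ y : M.Y, Tendsto (fun T : ℕ => vT M k T y) atTop (𝓝 (v y))) :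
    ∃ b T V, IsValueLimit M.ν M.state M.step (M.pairCost k) v b T V := by
  obtain ⟨V, hV, hπ⟩ := M.exists_valueIteration hk hC zero_le_one
  choose π hπ using hπ
  refine ⟨fun _ => 1, id, fun _ => V, fun _ => zero_le_one, fun _ => le_rfl, fun _ => hV, ?_,
    fun y => ?_⟩
  · simpa using tendsto_natCast_atTop_atTop
  · refine (hv y).congr fun T => ?_
    simp [vT_eq hk.measurable hC hV (hπ T)]

theorem exists_isValueLimit_of_tendsto_hEps (hk : Continuous (M.pairCost k))
    (hC : ∀ p, |M.pairCost k p| ≤ C) {v : M.Y → ℝ}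
    (hv : ∀ y : M.Y, Tendsto (fun ε : ℝ => hEps M k ε y) (𝓝[Ioo 0 1] 0) (𝓝 (v y))) :
    ∃ b T V, IsValueLimit M.ν M.state M.step (M.pairCost k) v b T V := by
  let e : ℕ → ℝ := fun j => ((j : ℝ) + 2)⁻¹
  let H : ℕ → ℕ := fun j => (j + 2) ^ 2
  have hpos : ∀ j, 0 < e j := fun j => by positivity
  have hlt : ∀ j, e j < 1 := fun j => inv_lt_one_of_one_lt₀ (by linarith [j.cast_nonneg (α := ℝ)])
  have hnn : ∀ j, 0 ≤ 1 - e j := fun j => by linarith [hlt j]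
  have htop : Tendsto (fun j : ℕ => (j : ℝ) + 2) atTop atTop :=
    tendsto_atTop_add_const_right _ _ tendsto_natCast_atTop_atTop
  have he : Tendsto e atTop (𝓝[Ioo 0 1] 0) :=
    tendsto_nhdsWithin_iff.mpr ⟨htop.inv_tendsto_atTop, .of_forall fun j => ⟨hpos j, hlt j⟩⟩
  have hpow : Tendsto (fun j => (1 - e j) ^ H j) atTop (𝓝 0) := by
    refine squeeze_zero (fun j => pow_nonneg (hnn j) _) (fun j => ?_)
      (Real.tendsto_exp_neg_atTop_nhds_zero.comp htop)
    refine (pow_le_pow_left₀ (hnn j) (Real.one_sub_le_exp_neg (e j)) _).trans_eq ?_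
    rw [← Real.exp_nat_mul, Function.comp_apply]
    congr 1
    simp only [e, H]
    push_cast
    field_simp
  have hsum : ∀ j, ∑ t ∈ Finset.range (H j), (1 - e j) ^ t = (1 - (1 - e j) ^ H j) / e j :=
    fun j => by
      rw [eq_div_iff (hpos j).ne', ← geom_sum_mul_neg, sub_sub_cancel]
  have hone : Tendsto (fun j => 1 - (1 - e j) ^ H j) atTop (𝓝 1) := by
    simpa using hpow.const_sub 1
  choose V hV hπ using fun j => M.exists_valueIteration hk hC (hnn j)
  choose π hπ using hπ
  refine ⟨fun j => 1 - e j, H, V, hnn, fun j => by linarith [hpos j], hV, ?_, fun y => ?_⟩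
  · simp only [hsum]
    simpa [e, div_eq_mul_inv] using hone.pos_mul_atTop one_pos htop
  · have h1 : Tendsto (fun j => e j * V j (H j) y) atTop (𝓝 (v y)) := by
      have h2 : Tendsto (fun j => hEps M k (e j) y - e j * V j (H j) y) atTop (𝓝 0) :=
        squeeze_zero_norm (fun j => abs_hEps_sub_le hk.measurable hC (hpos j) (hlt j) (hV j)
          (hπ j (H j)) y) (by simpa using hpow.const_mul C)
      simpa using ((hv y).comp he).sub h2
    simp only [hsum]
    refine ((h1.div hone one_ne_zero).congr fun j => ?_).trans_eq (by rw [div_one])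
    rw [div_div_eq_mul_div, mul_comm]
    rfl

end Values

section DualValues

variable {M : Model n Uc S} {k : (Fin n → ℝ) → Uc → ℝ} {C : ℝ} {v : M.Y → ℝ} {b : ℕ → ℝ}
  {T : ℕ → ℕ} {V : ℕ → ℕ → M.Y → ℝ}

theorem DualFeas.le_of_isValueLimit (h : IsValueLimit M.ν M.state M.step (M.pairCost k) v b T V)
    {ψ η : (Fin n → ℝ) → ℝ} (hψ : Measurable ψ) (hη : Measurable η) {B D μ : ℝ}
    (hψB : ∀ y ∈ M.Y, |ψ y| ≤ B) (hηD : ∀ y ∈ M.Y, |η y| ≤ D) {y0 : M.Y}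
    (hf : DualFeas M k y0 ψ η μ) : μ ≤ v y0 :=
  h.le_of_dualFeasible M.measurable_step (ψ := fun y => ψ y) (η := fun y => η y)
    (hψ.comp measurable_subtype_coe) (hη.comp measurable_subtype_coe) (fun y => hψB y y.2)
    (fun y => hηD y y.2) (fun p => hf.1 (p.1.1, p.1.2) ⟨p.1.1.2, p.2⟩)
    fun p => hf.2 (p.1.1, p.1.2) ⟨p.1.1.2, p.2⟩

theorem exists_dualFeas (h : IsValueLimit M.ν M.state M.step (M.pairCost k) v b T V)
    (hk : Continuous (M.pairCost k)) (hC : ∀ p, |M.pairCost k p| ≤ C) (hv : Continuous v)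
    (y0 : M.Y) {δ : ℝ} (hδ : 0 < δ) : ∃ ψ η : BoundedContinuousFunction (Fin n → ℝ) ℝ,
      DualFeas M k y0 ψ η (v y0 - δ) := by
  obtain ⟨p0, -⟩ := M.surjective_state y0
  obtain ⟨η, hη⟩ := h.exists_dual M.continuous_state M.continuous_step M.measurable_step hk
    ((abs_nonneg _).trans (hC p0)) hC hv hδ
  have hcl := M.Y_compact.isClosed.isClosedEmbedding_subtypeVal
  obtain ⟨ψ', -, hψ'⟩ := BoundedContinuousFunction.exists_extension_norm_eq_of_isClosedEmbedding
    (BoundedContinuousFunction.mkOfCompact ⟨v, hv⟩) hcl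
  obtain ⟨η', -, hη'⟩ := BoundedContinuousFunction.exists_extension_norm_eq_of_isClosedEmbedding
    (BoundedContinuousFunction.mkOfCompact η) hcl
  have hψ : ∀ y : M.Y, ψ' y = v y := fun y => congrFun hψ' y
  have hη'' : ∀ y : M.Y, η' y = η y := fun y => congrFun hη' y
  refine ⟨ψ', η', ?_, ?_⟩
  · rintro ⟨y, u⟩ ⟨hy, hu⟩
    have h1 := hη ⟨(⟨y, hy⟩, u), hu⟩
    have h2 : Ef M η' y u = ∫ s, η (M.step ⟨(⟨y, hy⟩, u), hu⟩ s) ∂M.ν :=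
      integral_congr_ae (ae_of_all _ fun s => hη'' (M.step ⟨(⟨y, hy⟩, u), hu⟩ s))
    have h3 := hψ ⟨y, hy⟩
    have h4 := hη'' ⟨y, hy⟩
    simp only [Model.pairCost, Model.state] at h1
    simp only [h2, h3, h4, hψ y0]
    linarith
  · rintro ⟨y, u⟩ ⟨hy, hu⟩
    have h1 := h.le_integral M.measurable_step hC ⟨(⟨y, hy⟩, u), hu⟩
    have h2 : Ef M ψ' y u = ∫ s, v (M.step ⟨(⟨y, hy⟩, u), hu⟩ s) ∂M.ν :=
      integral_congr_ae (ae_of_all _ fun s => hψ (M.step ⟨(⟨y, hy⟩, u), hu⟩ s))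
    have h3 := hψ ⟨y, hy⟩
    simp only [Model.state] at h1
    simp only [h2, h3]
    linarith

theorem dStar_eq (h : IsValueLimit M.ν M.state M.step (M.pairCost k) v b T V)
    (hk : Continuous (M.pairCost k)) (hC : ∀ p, |M.pairCost k p| ≤ C) (hv : Continuous v)
    (y0 : M.Y) : dStar M k y0 = v y0 := by
  refine csSup_eq_of_forall_le_of_forall_lt_exists_gt ?_ ?_ fun w hw => ?_
  · obtain ⟨ψ, η, hf⟩ := exists_dualFeas h hk hC hv y0 one_pos
    exact ⟨_, ψ, η, ψ.continuous, η.continuous, hf⟩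
  · rintro μ ⟨ψ, η, hψ, hη, hf⟩
    obtain ⟨B, hB⟩ := M.Y_compact.exists_bound_of_continuousOn hψ.continuousOn
    obtain ⟨D, hD⟩ := M.Y_compact.exists_bound_of_continuousOn hη.continuousOn
    exact hf.le_of_isValueLimit h hψ.measurable hη.measurable hB hD
  · obtain ⟨ψ, η, hf⟩ := exists_dualFeas h hk hC hv y0 (half_pos (sub_pos.mpr hw))
    exact ⟨_, ⟨ψ, η, ψ.continuous, η.continuous, hf⟩, by linarith⟩

theorem dHatStar_eq (h : IsValueLimit M.ν M.state M.step (M.pairCost k) v b T V)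
    (hk : Continuous (M.pairCost k)) (hC : ∀ p, |M.pairCost k p| ≤ C) (hv : Continuous v)
    (y0 : M.Y) : dHatStar M k y0 = v y0 := by
  have hbdd : ∀ ψ : BoundedContinuousFunction (Fin n → ℝ) ℝ, BddBorel ψ := fun ψ =>
    ⟨ψ.continuous.measurable, ‖ψ‖, ψ.norm_coe_le_norm⟩
  refine csSup_eq_of_forall_le_of_forall_lt_exists_gt ?_ ?_ fun w hw => ?_
  · obtain ⟨ψ, η, hf⟩ := exists_dualFeas h hk hC hv y0 one_pos
    exact ⟨_, ψ, η, hbdd ψ, hbdd η, hf⟩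
  · rintro μ ⟨ψ, η, ⟨hψ, B, hB⟩, ⟨hη, D, hD⟩, hf⟩
    exact hf.le_of_isValueLimit h hψ hη (fun y _ => hB y) fun y _ => hD y
  · obtain ⟨ψ, η, hf⟩ := exists_dualFeas h hk hC hv y0 (half_pos (sub_pos.mpr hw))
    exact ⟨_, ⟨ψ, η, hbdd ψ, hbdd η, hf⟩, by linarith⟩

end DualValues

/-- if `v_T` converges pointwise on `Y` to a continuous limit, or `h_ε`
converges pointwise on `Y` to a continuous limit, then `d*(y₀) = d̂*(y₀)` for all `y₀ ∈ Y`. -/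
theorem statement12 (M : Model n Uc S) (k : (Fin n → ℝ) → Uc → ℝ)
    (hk : ContinuousOn (fun p : (Fin n → ℝ) × Uc => k p.1 p.2) (M.Y ×ˢ (univ : Set Uc)))
    (C : ℝ) (hkC : ∀ y ∈ M.Y, ∀ u : Uc, |k y u| ≤ C)
    (hlim :
      (∃ v : (Fin n → ℝ) → ℝ,
        (∀ y ∈ M.Y, Tendsto (fun T : ℕ => vT M k T y) atTop (𝓝 (v y))) ∧
        ContinuousOn v M.Y) ∨
      (∃ h : (Fin n → ℝ) → ℝ,
        (∀ y ∈ M.Y,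
          Tendsto (fun ε : ℝ => hEps M k ε y) (𝓝[Set.Ioo (0 : ℝ) 1] 0) (𝓝 (h y))) ∧
        ContinuousOn h M.Y)) :
    ∀ y0 ∈ M.Y, dStar M k y0 = dHatStar M k y0 := by
  have hk' := M.continuous_pairCost hk
  have hC : ∀ p, |M.pairCost k p| ≤ C := fun p => hkC _ p.1.1.2 _
  obtain ⟨v, hv, b, T, V, h⟩ : ∃ v : M.Y → ℝ, Continuous v ∧
      ∃ b T V, IsValueLimit M.ν M.state M.step (M.pairCost k) v b T V := by
    rcases hlim with ⟨v, hlim, hv⟩ | ⟨v, hlim, hv⟩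
    · exact ⟨fun y => v y, continuousOn_iff_continuous_domRestrict.mp hv,
        exists_isValueLimit_of_tendsto_vT hk' hC fun y => hlim y y.2⟩
    · exact ⟨fun y => v y, continuousOn_iff_continuous_domRestrict.mp hv,
        exists_isValueLimit_of_tendsto_hEps hk' hC fun y => hlim y y.2⟩
  exact fun y0 hy0 => (dStar_eq h hk' hC hv ⟨y0, hy0⟩).trans (dHatStar_eq h hk' hC hv ⟨y0, hy0⟩).symm

end StochLP
end
end

section
/- For every y0 ∈ Y, limsup_{T→∞} Γ_T(y0) ⊂ W ∩ D1(y0); that is, if T_l → ∞ and γ_l ∈ Γ_{T_l}(y0) converge weak* to γ ∈ P(G), then γ ∈ W ∩ D1(y0). -/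
open MeasureTheory Filter Set Topology
open scoped ENNReal NNReal

noncomputable section

namespace StochLP

variable {n : ℕ} {Uc S : Type} [MetricSpace Uc] [CompactSpace Uc] [MeasurableSpace Uc]
  [BorelSpace Uc] [TopologicalSpace S] [PolishSpace S] [MeasurableSpace S] [BorelSpace S]

open ProbabilityTheory

/-- A function continuous on a compact subset of a normal space agrees there with a bounded
continuous function. -/
lemma exists_boundedContinuous_eqOn {X : Type*} [TopologicalSpace X] [T2Space X] [NormalSpace X]
    {K : Set X} (hK : IsCompact K) {F : X → ℝ} (hF : ContinuousOn F K) :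
    ∃ g : BoundedContinuousFunction X ℝ, EqOn g F K := by
  have : CompactSpace K := isCompact_iff_compactSpace.mp hK
  obtain ⟨g, -, hg⟩ := BoundedContinuousFunction.exists_norm_eq_domRestrict_eq_of_closed
    (BoundedContinuousFunction.mkOfCompact ⟨K.domRestrict F, hF.domRestrict⟩) hK.isClosed
  exact ⟨g, fun x hx => DFunLike.congr_fun hg ⟨x, hx⟩⟩

section Concentrated

variable {X : Type*} [TopologicalSpace X] [T2Space X] [NormalSpace X]
  [MeasurableSpace X] [OpensMeasurableSpace X] {K : Set X} {F : X → ℝ}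

lemma integrable_of_continuousOn_of_ae_mem (hK : IsCompact K) (hF : ContinuousOn F K)
    {μ : Measure X} [IsFiniteMeasure μ] (hμ : ∀ᵐ x ∂μ, x ∈ K) : Integrable F μ := by
  obtain ⟨g, hg⟩ := exists_boundedContinuous_eqOn hK hF
  refine (g.integrable μ).congr ?_
  filter_upwards [hμ] with x hx using hg hx

lemma tendsto_integral_of_continuousOn_of_ae_mem (hK : IsCompact K) (hF : ContinuousOn F K)
    {ι : Type*} {L : Filter ι} {μs : ι → ProbabilityMeasure X} {μ : ProbabilityMeasure X}
    (hlim : Tendsto μs L (𝓝 μ)) (hμs : ∀ i, ∀ᵐ x ∂(μs i).toMeasure, x ∈ K)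
    (hμ : ∀ᵐ x ∂μ.toMeasure, x ∈ K) :
    Tendsto (fun i => ∫ x, F x ∂(μs i).toMeasure) L (𝓝 (∫ x, F x ∂μ.toMeasure)) := by
  obtain ⟨g, hg⟩ := exists_boundedContinuous_eqOn hK hF
  have key : ∀ ν : Measure X, (∀ᵐ x ∂ν, x ∈ K) → ∫ x, g x ∂ν = ∫ x, F x ∂ν := fun ν hν =>
    integral_congr_ae (hν.mono fun x hx => hg hx)
  simpa only [key _ hμ, key _ (hμs _)] using
    ProbabilityMeasure.tendsto_iff_forall_integral_tendsto.mp hlim g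

end Concentrated

lemma ae_mem_of_tendsto {X : Type*} [TopologicalSpace X] [MeasurableSpace X]
    [OpensMeasurableSpace X] [HasOuterApproxClosed X] {K : Set X} (hK : IsClosed K)
    {ι : Type*} {L : Filter ι} [L.NeBot] {μs : ι → ProbabilityMeasure X}
    {μ : ProbabilityMeasure X} (hlim : Tendsto μs L (𝓝 μ))
    (hμs : ∀ i, ∀ᵐ x ∂(μs i).toMeasure, x ∈ K) : ∀ᵐ x ∂μ.toMeasure, x ∈ K := by
  have h := ProbabilityMeasure.limsup_measure_closed_le_of_tendsto hlim hK
  have h1 : ∀ i, (μs i).toMeasure K = 1 := fun i => mem_ae_iff_prob_eq_one hK.measurableSet |>.mp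
    (hμs i)
  simp only [h1, limsup_const] at h
  exact (mem_ae_iff_prob_eq_one hK.measurableSet).mpr (le_antisymm prob_le_one h)

instance (M : Model n Uc S) : IsProbabilityMeasure M.ν := M.ν_prob

lemma isCompact_graphG (M : Model n Uc S) : IsCompact (graphG M) :=
  (M.Y_compact.prod isCompact_univ).of_isClosed_subset M.graph_closed fun _ hp =>
    ⟨hp.1, mem_univ _⟩

lemma onG_iff_ae_mem (M : Model n Uc S) (γ : Measure ((Fin n → ℝ) × Uc)) :
    onG M γ ↔ ∀ᵐ p ∂γ, p ∈ graphG M := Iff.rfl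

lemma continuousOn_Ef (M : Model n Uc S) {φ : (Fin n → ℝ) → ℝ} (hφ : Continuous φ) :
    ContinuousOn (fun p : (Fin n → ℝ) × Uc => Ef M φ p.1 p.2) (graphG M) := by
  obtain ⟨C, hC⟩ := M.Y_compact.exists_bound_of_continuousOn hφ.continuousOn
  refine continuousOn_of_dominated (bound := fun _ => C) (fun p hp => ?_) (fun p hp => ?_)
    (integrable_const C) (ae_of_all _ fun s => ?_)
  · exact (hφ.measurable.comp (M.f_meas p.1 hp.1 p.2)).aestronglyMeasurable
  · exact ae_of_all _ fun s => hC _ (M.f_inv _ hp.1 _ hp.2 s)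
  · exact hφ.comp_continuousOn ((M.f_cont s).mono fun p hp => ⟨hp.1, mem_univ _⟩)

/-- The one-step motion under the feedback `p`, frozen outside the state space `Y`. -/
def policyStep (M : Model n Uc S) (p : (Fin n → ℝ) → Uc) (q : (Fin n → ℝ) × S) : Fin n → ℝ :=
  open Classical in if q.1 ∈ M.Y then M.f q.1 (p q.1) q.2 else q.1

lemma measurable_policyStep (M : Model n Uc S) {p : (Fin n → ℝ) → Uc} (hp : Measurable p) :
    Measurable (policyStep M p) := by
  have hY : MeasurableSet {q : (Fin n → ℝ) × S | q.1 ∈ M.Y} :=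
    measurable_fst M.Y_compact.measurableSet
  have hf : Measurable (Function.uncurry fun (i : M.Y × Uc) (s : S) => M.f i.1 i.2 s) := by
    refine measurable_uncurry_of_continuous_of_measurable (fun s => ?_) fun i =>
      M.f_meas _ i.1.2 _
    exact (M.f_cont s).comp_continuous (by fun_prop : Continuous fun i : M.Y × Uc =>
      ((i.1 : Fin n → ℝ), i.2)) fun i => ⟨i.1.2, mem_univ _⟩
  refine measurable_of_restrict_of_restrict_compl hY ?_ ?_
  · have hg : Measurable fun q : {q : (Fin n → ℝ) × S | q.1 ∈ M.Y} =>
        (((⟨q.1.1, q.2⟩ : M.Y), p q.1.1), q.1.2) := by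
      refine Measurable.prodMk (Measurable.prodMk ?_ ?_) ?_
      · exact Measurable.subtype_mk (by fun_prop)
      · fun_prop
      · fun_prop
    convert hf.comp hg using 1
    funext q
    exact if_pos q.2
  · have hg : Measurable fun q : ↥{q : (Fin n → ℝ) × S | q.1 ∈ M.Y}ᶜ => q.1.1 := by fun_prop
    convert hg using 1
    funext q
    exact if_neg q.2

/-- The transition kernel of the controlled recursion under the feedback `p`, trivial outside the
state space `Y`. -/
def transition (M : Model n Uc S) (p : (Fin n → ℝ) → Uc) (hp : Measurable p) :
    Kernel (Fin n → ℝ) (Fin n → ℝ) where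
  toFun y := (M.ν.map (Prod.mk y)).map (policyStep M p)
  measurable' := (Measure.measurable_map _ (measurable_policyStep M hp)).comp
    Measurable.map_prodMk_left

lemma transition_eq_map_policyStep (M : Model n Uc S) {p : (Fin n → ℝ) → Uc} (hp : Measurable p)
    (y : Fin n → ℝ) : transition M p hp y = M.ν.map fun s => policyStep M p (y, s) :=
  Measure.map_map (measurable_policyStep M hp) measurable_prodMk_left

lemma transition_apply (M : Model n Uc S) {p : (Fin n → ℝ) → Uc} (hp : Measurable p)
    {y : Fin n → ℝ} (hy : y ∈ M.Y) : transition M p hp y = M.ν.map fun s => M.f y (p y) s := by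
  rw [transition_eq_map_policyStep]
  congr 1
  funext s
  exact if_pos hy

instance (M : Model n Uc S) (p : (Fin n → ℝ) → Uc) (hp : Measurable p) :
    IsMarkovKernel (transition M p hp) where
  isProbabilityMeasure y := by
    rw [transition_eq_map_policyStep]
    exact Measure.isProbabilityMeasure_map
      ((measurable_policyStep M hp).comp measurable_prodMk_left).aemeasurable

lemma ae_transition_mem (M : Model n Uc S) {p : (Fin n → ℝ) → Uc} (hp : Measurable p)
    (hpU : ∀ y ∈ M.Y, p y ∈ M.U y) {y : Fin n → ℝ} (hy : y ∈ M.Y) :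
    ∀ᵐ z ∂transition M p hp y, z ∈ M.Y := by
  rw [transition_apply M hp hy]
  refine (ae_map_iff (M.f_meas y hy _).aemeasurable M.Y_compact.measurableSet).mpr ?_
  exact ae_of_all _ fun s => M.f_inv _ hy _ (hpU y hy) s

lemma integral_transition (M : Model n Uc S) {p : (Fin n → ℝ) → Uc} (hp : Measurable p)
    {φ : (Fin n → ℝ) → ℝ} (hφ : Continuous φ) {y : Fin n → ℝ} (hy : y ∈ M.Y) :
    ∫ z, φ z ∂transition M p hp y = Ef M φ y (p y) := by
  rw [transition_apply M hp hy, integral_map (M.f_meas y hy _).aemeasurable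
    hφ.aestronglyMeasurable]
  rfl

/-- The plan which at time `t` uses the feedback of `π` at time `t + 1`. -/
def Plan.shift_s13 {M : Model n Uc S} (π : Plan M) : Plan M where
  π t := π.π (t + 1)
  measurable t := π.measurable (t + 1)
  feasible t := π.feasible (t + 1)

/-- The `t`-step transition kernel of the recursion controlled by the plan `π`. -/
def planKernel {M : Model n Uc S} (π : Plan M) : ℕ → Kernel (Fin n → ℝ) (Fin n → ℝ)
  | 0 => Kernel.id
  | t + 1 => transition M (π.π t) (π.measurable t) ∘ₖ planKernel π t

instance {M : Model n Uc S} (π : Plan M) (t : ℕ) : IsMarkovKernel (planKernel π t) := by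
  induction t with
  | zero => exact inferInstanceAs (IsMarkovKernel Kernel.id)
  | succ t ih => exact inferInstanceAs (IsMarkovKernel (_ ∘ₖ planKernel π t))

lemma planKernel_succ_eq_shift {M : Model n Uc S} (π : Plan M) (t : ℕ) :
    planKernel π (t + 1) = planKernel π.shift_s13 t ∘ₖ transition M (π.π 0) (π.measurable 0) := by
  induction t with
  | zero => simp [planKernel]
  | succ t ih =>
    rw [planKernel, ih, ← Kernel.comp_assoc]
    rfl

lemma ae_planKernel_mem {M : Model n Uc S} (π : Plan M) (t : ℕ) {y : Fin n → ℝ} (hy : y ∈ M.Y) :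
    ∀ᵐ z ∂planKernel π t y, z ∈ M.Y := by
  induction t with
  | zero =>
    rw [planKernel, Kernel.id_apply]
    exact (ae_dirac_iff M.Y_compact.measurableSet).mpr hy
  | succ t ih =>
    refine Kernel.ae_comp_of_ae_ae M.Y_compact.measurableSet ?_
    filter_upwards [ih] with z hz using ae_transition_mem M _ (π.feasible t) hz

lemma stateLaw_eq_planKernel {M : Model n Uc S} (π : Plan M) (t : ℕ) {y : Fin n → ℝ}
    (hy : y ∈ M.Y) : stateLaw M t π.π y = planKernel π t y := by
  induction t generalizing π y with
  | zero => exact (Kernel.id_apply y).symm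
  | succ t ih =>
    rw [planKernel_succ_eq_shift, Kernel.comp_apply]
    change (M.ν.map fun s => M.f y (π.π 0 y) s).bind (fun z => stateLaw M t π.shift_s13.π z) = _
    rw [← transition_apply M (π.measurable 0) hy]
    refine Measure.bind_congr_right ?_
    filter_upwards [ae_transition_mem M (π.measurable 0) (π.feasible 0) hy] with z hz using
      ih π.shift_s13 hz

lemma measurable_graphMap {M : Model n Uc S} (π : Plan M) (t : ℕ) :
    Measurable fun z : Fin n → ℝ => (z, π.π t z) :=
  measurable_id.prodMk (π.measurable t)

lemma saLaw_eq_map_planKernel {M : Model n Uc S} (π : Plan M) (t : ℕ) {y : Fin n → ℝ}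
    (hy : y ∈ M.Y) : saLaw M t π.π y = (planKernel π t y).map fun z => (z, π.π t z) := by
  rw [saLaw, stateLaw_eq_planKernel π t hy]

lemma isProbabilityMeasure_saLaw {M : Model n Uc S} (π : Plan M) (t : ℕ) {y : Fin n → ℝ}
    (hy : y ∈ M.Y) : IsProbabilityMeasure (saLaw M t π.π y) := by
  rw [saLaw_eq_map_planKernel π t hy]
  exact Measure.isProbabilityMeasure_map (measurable_graphMap π t).aemeasurable

lemma onG_saLaw {M : Model n Uc S} (π : Plan M) (t : ℕ) {y : Fin n → ℝ} (hy : y ∈ M.Y) :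
    onG M (saLaw M t π.π y) := by
  rw [onG_iff_ae_mem, saLaw_eq_map_planKernel π t hy]
  refine (ae_map_iff (measurable_graphMap π t).aemeasurable
    (isCompact_graphG M).measurableSet).mpr ?_
  filter_upwards [ae_planKernel_mem π t hy] with z hz using ⟨hz, π.feasible t z hz⟩

lemma integrable_saLaw {M : Model n Uc S} (π : Plan M) (t : ℕ) {y : Fin n → ℝ} (hy : y ∈ M.Y)
    {F : (Fin n → ℝ) × Uc → ℝ} (hF : ContinuousOn F (graphG M)) :
    Integrable F (saLaw M t π.π y) :=
  have := isProbabilityMeasure_saLaw π t hy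
  integrable_of_continuousOn_of_ae_mem (isCompact_graphG M) hF (onG_saLaw π t hy)

lemma integral_saLaw {M : Model n Uc S} (π : Plan M) (t : ℕ) {y : Fin n → ℝ} (hy : y ∈ M.Y)
    {F : (Fin n → ℝ) × Uc → ℝ} (hF : ContinuousOn F (graphG M)) :
    ∫ p, F p ∂saLaw M t π.π y = ∫ z, F (z, π.π t z) ∂planKernel π t y := by
  have h := (integrable_saLaw π t hy hF).aestronglyMeasurable
  rw [saLaw_eq_map_planKernel π t hy] at h ⊢
  exact integral_map (measurable_graphMap π t).aemeasurable h

lemma integrable_planKernel {M : Model n Uc S} (π : Plan M) (t : ℕ) {y : Fin n → ℝ} (hy : y ∈ M.Y)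
    {φ : (Fin n → ℝ) → ℝ} (hφ : Continuous φ) : Integrable φ (planKernel π t y) :=
  integrable_of_continuousOn_of_ae_mem M.Y_compact hφ.continuousOn (ae_planKernel_mem π t hy)

lemma integral_planKernel_succ {M : Model n Uc S} (π : Plan M) (t : ℕ) {y : Fin n → ℝ}
    (hy : y ∈ M.Y) {φ : (Fin n → ℝ) → ℝ} (hφ : Continuous φ) :
    ∫ z, φ z ∂planKernel π (t + 1) y = ∫ p, Ef M φ p.1 p.2 ∂saLaw M t π.π y := by
  rw [integral_saLaw π t hy (continuousOn_Ef M hφ), planKernel,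
    Kernel.integral_comp (integrable_planKernel π (t + 1) hy hφ)]
  refine integral_congr_ae ?_
  filter_upwards [ae_planKernel_mem π t hy] with z hz using integral_transition M _ hφ hz

lemma continuousOn_increment (M : Model n Uc S) {φ : (Fin n → ℝ) → ℝ} (hφ : Continuous φ) :
    ContinuousOn (fun p : (Fin n → ℝ) × Uc => Ef M φ p.1 p.2 - φ p.1) (graphG M) :=
  (continuousOn_Ef M hφ).sub (hφ.comp continuous_fst).continuousOn

lemma sum_integral_increment {M : Model n Uc S} (π : Plan M) (T : ℕ) {y : Fin n → ℝ}
    (hy : y ∈ M.Y) {φ : (Fin n → ℝ) → ℝ} (hφ : Continuous φ) :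
    ∑ t ∈ Finset.range T, ∫ p, (Ef M φ p.1 p.2 - φ p.1) ∂saLaw M t π.π y =
      ∫ z, φ z ∂planKernel π T y - φ y := by
  have hstep : ∀ t, ∫ p, (Ef M φ p.1 p.2 - φ p.1) ∂saLaw M t π.π y =
      ∫ z, φ z ∂planKernel π (t + 1) y - ∫ z, φ z ∂planKernel π t y := fun t => by
    have hfst : ContinuousOn (fun p : (Fin n → ℝ) × Uc => φ p.1) (graphG M) := by fun_prop
    rw [integral_sub (integrable_saLaw π t hy (continuousOn_Ef M hφ))
      (integrable_saLaw π t hy hfst), integral_planKernel_succ π t hy hφ]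
    congr 1
    exact integral_saLaw π t hy hfst
  rw [Finset.sum_congr rfl fun t _ => hstep t,
    Finset.sum_range_sub (fun t => ∫ z, φ z ∂planKernel π t y)]
  simp [planKernel, Kernel.id_apply]

lemma abs_integral_planKernel_le {M : Model n Uc S} (π : Plan M) (t : ℕ) {y : Fin n → ℝ}
    (hy : y ∈ M.Y) {φ : (Fin n → ℝ) → ℝ} {C : ℝ} (hC : ∀ z ∈ M.Y, ‖φ z‖ ≤ C) :
    |∫ z, φ z ∂planKernel π t y| ≤ C := by
  have h := norm_integral_le_of_norm_le_const (μ := planKernel π t y)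
    ((ae_planKernel_mem π t hy).mono hC)
  simpa using h

lemma integral_occT {M : Model n Uc S} (π : Plan M) (T : ℕ) {y : Fin n → ℝ} (hy : y ∈ M.Y)
    {F : (Fin n → ℝ) × Uc → ℝ} (hF : ContinuousOn F (graphG M)) :
    ∫ p, F p ∂occT M T π.π y = (T : ℝ)⁻¹ * ∑ t ∈ Finset.range T, ∫ p, F p ∂saLaw M t π.π y := by
  rw [occT, integral_smul_measure, integral_finsetSum_measure fun t _ =>
    integrable_saLaw π t hy hF]
  simp

lemma onG_smul {M : Model n Uc S} {γ : Measure ((Fin n → ℝ) × Uc)} (hγ : onG M γ) (c : ℝ≥0∞) :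
    onG M (c • γ) :=
  Measure.ae_smul_measure hγ c

lemma onG_finsetSum {M : Model n Uc S} {ι : Type*} (s : Finset ι)
    {γ : ι → Measure ((Fin n → ℝ) × Uc)} (hγ : ∀ i ∈ s, onG M (γ i)) :
    onG M (∑ i ∈ s, γ i) := by
  rw [onG, Measure.finsetSum_apply]
  exact Finset.sum_eq_zero hγ

lemma onG_occT {M : Model n Uc S} (π : Plan M) (T : ℕ) {y : Fin n → ℝ} (hy : y ∈ M.Y) :
    onG M (occT M T π.π y) :=
  onG_smul (onG_finsetSum _ fun t _ => onG_saLaw π t hy) _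

/-- The average over `τ < T` of the unnormalized occupational measures up to time `τ`. -/
def accumulatedOcc (M : Model n Uc S) (T : ℕ) (π : ℕ → (Fin n → ℝ) → Uc) (y0 : Fin n → ℝ) :
    Measure ((Fin n → ℝ) × Uc) :=
  (T : ℝ≥0∞)⁻¹ • ∑ τ ∈ Finset.range T, ∑ t ∈ Finset.range τ, saLaw M t π y0

lemma onG_accumulatedOcc {M : Model n Uc S} (π : Plan M) (T : ℕ) {y : Fin n → ℝ} (hy : y ∈ M.Y) :
    onG M (accumulatedOcc M T π.π y) :=
  onG_smul (onG_finsetSum _ fun _ _ => onG_finsetSum _ fun t _ => onG_saLaw π t hy) _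

lemma isFiniteMeasure_accumulatedOcc {M : Model n Uc S} (π : Plan M) {T : ℕ} (hT : 0 < T)
    {y : Fin n → ℝ} (hy : y ∈ M.Y) : IsFiniteMeasure (accumulatedOcc M T π.π y) := by
  have := fun t => isProbabilityMeasure_saLaw π t hy
  exact Measure.smul_finite _ (ENNReal.inv_ne_top.mpr (by exact_mod_cast hT.ne'))

lemma integral_increment_accumulatedOcc {M : Model n Uc S} (π : Plan M) (T : ℕ)
    {y : Fin n → ℝ} (hy : y ∈ M.Y) {φ : (Fin n → ℝ) → ℝ} (hφ : Continuous φ) :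
    ∫ p, (Ef M φ p.1 p.2 - φ p.1) ∂accumulatedOcc M T π.π y =
      ∫ p, (φ p.1 - φ y) ∂occT M T π.π y := by
  have hint := fun t => integrable_saLaw π t hy (continuousOn_increment M hφ)
  have hcont : Continuous fun p : (Fin n → ℝ) × Uc => φ p.1 - φ y := by fun_prop
  rw [integral_occT π T hy hcont.continuousOn, accumulatedOcc, integral_smul_measure,
    integral_finsetSum_measure fun τ _ => integrable_finsetSum_measure.mpr fun t _ => hint t]
  simp only [ENNReal.toReal_inv, ENNReal.toReal_natCast, smul_eq_mul]
  congr 1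
  refine Finset.sum_congr rfl fun τ _ => ?_
  rw [integral_finsetSum_measure fun t _ => hint t, sum_integral_increment π τ hy hφ,
    integral_saLaw π τ hy hcont.continuousOn,
    integral_sub (integrable_planKernel π τ hy hφ) (integrable_const _)]
  simp

/-- `limsup_{T→∞} Γ_T(y₀) ⊂ W ∩ D₁(y₀)`: if `T_l → ∞` and occupational
measures `γ_l ∈ Γ_{T_l}(y₀)` converge in the weak* topology to `γ`, then
`γ ∈ W ∩ D₁(y₀)`. -/
theorem statement13 (M : Model n Uc S) (y0 : Fin n → ℝ) (hy0 : y0 ∈ M.Y)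
    (Tl : ℕ → ℕ) (hTpos : ∀ l, 0 < Tl l) (hT : Tendsto Tl atTop atTop)
    (γl : ℕ → ProbabilityMeasure ((Fin n → ℝ) × Uc))
    (hmem : ∀ l, γl l ∈ GammaT M (Tl l) y0)
    (γ : ProbabilityMeasure ((Fin n → ℝ) × Uc))
    (hconv : Tendsto γl atTop (𝓝 γ)) :
    γ.toMeasure ∈ Wset M ∧ D1mem M y0 γ.toMeasure := by
  choose π hπ using hmem
  have hGl : ∀ l, onG M (γl l).toMeasure := fun l => by
    rw [hπ l]
    exact onG_occT (π l) (Tl l) hy0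
  have hG : onG M γ.toMeasure := ae_mem_of_tendsto M.graph_closed hconv hGl
  have hlim : ∀ F : (Fin n → ℝ) × Uc → ℝ, ContinuousOn F (graphG M) →
      Tendsto (fun l => ∫ p, F p ∂occT M (Tl l) (π l).π y0) atTop (𝓝 (∫ p, F p ∂γ.toMeasure)) :=
    fun F hF => by
      simpa only [hπ] using
        tendsto_integral_of_continuousOn_of_ae_mem (isCompact_graphG M) hF hconv hGl hG
  refine ⟨⟨inferInstance, hG, fun φ hφ => ?_⟩,
    fun l => accumulatedOcc M (Tl l) (π l).π y0, fun l =>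
      ⟨isFiniteMeasure_accumulatedOcc (π l) (hTpos l) hy0, onG_accumulatedOcc (π l) (Tl l) hy0⟩,
    fun φ hφ => ?_⟩
  · refine tendsto_nhds_unique (hlim _ (continuousOn_increment M hφ)) ?_
    obtain ⟨C, hC⟩ := M.Y_compact.exists_bound_of_continuousOn hφ.continuousOn
    have hinv : Tendsto (fun l => (Tl l : ℝ)⁻¹ * (C + C)) atTop (𝓝 0) := by
      simpa using (tendsto_inv_atTop_zero.comp
        (tendsto_natCast_atTop_atTop.comp hT)).mul_const (C + C)
    refine squeeze_zero_norm (fun l => ?_) hinv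
    rw [integral_occT (π l) (Tl l) hy0 (continuousOn_increment M hφ),
      sum_integral_increment (π l) (Tl l) hy0 hφ, norm_mul, norm_inv, Real.norm_natCast]
    gcongr
    exact (norm_sub_le _ _).trans
      (add_le_add (abs_integral_planKernel_le (π l) (Tl l) hy0 hC) (hC y0 hy0))
  · simp only [integral_increment_accumulatedOcc (π _) (Tl _) hy0 hφ]
    exact hlim _ (by fun_prop)

end StochLP
end
end
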